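/- arXiv:2308.11286 — 2 statements merged into one kernel-verified Lean document; each statement's English description precedes it below -/
import Mathlib

section
/- Let A ⊆ ℕ be a set of positive lower density. Then for Haar-almost every α ∈ 𝕋 (with continued fraction expansion [0; a₁, a₂, …] and convergent denominators q_k) there exists a strictly increasing sequence (k_j)_{j∈ℕ} of odd positive integers such that q_{k_j} ∈ A for all j and (Σ_{i=1}^{k_j} a_i)/a_{k_j + 1} → 0 as j → ∞. -/
open MeasureTheory Filter Set Topology

noncomputable def toCircle (x : ℝ) : UnitAddCircle := x

/-- The canonical embedding `ι : 𝕋 → [0,1) ⊆ ℝ`. -/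
noncomputable def iota (x : UnitAddCircle) : ℝ := (AddCircle.equivIco 1 0 x : ℝ)

/-- The Birkhoff sum `S_N(f, α, x₀) = ∑_{k=0}^{N-1} f(x₀ + kα)`. -/
noncomputable def birkhoff (f : UnitAddCircle → ℝ) (α x₀ : UnitAddCircle) (N : ℕ) : ℝ :=
  ∑ k ∈ Finset.range N, f (x₀ + k • α)

/-- Iterates of the Gauss map, starting from the fractional part of `α`. -/
noncomputable def gaussIter (α : ℝ) : ℕ → ℝ
  | 0 => Int.fract α
  | n + 1 => Int.fract (1 / gaussIter α n)

/-- The `k`-th partial quotient `a_k(α)` (for `k ≥ 1`) of the continued fraction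
expansion of `α`. -/
noncomputable def cfA (α : ℝ) (k : ℕ) : ℕ := ⌊1 / gaussIter α (k - 1)⌋₊

/-- The denominators `q_k(α)` of the convergents of `α`:
`q₀ = 1`, `q₁ = a₁`, `q_{k+1} = a_{k+1} q_k + q_{k-1}`. -/
noncomputable def cfQ (α : ℝ) : ℕ → ℕ
  | 0 => 1
  | 1 => cfA α 1
  | (k + 2) => cfA α (k + 2) * cfQ α (k + 1) + cfQ α k

open scoped Classical in
/-- The lower (asymptotic) density of a set `A ⊆ ℕ`:
`liminf_{N → ∞} #(A ∩ {1,…,N}) / N`. -/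
noncomputable def lowerDensity (A : Set ℕ) : ℝ :=
  Filter.liminf (fun N : ℕ => (((Finset.Icc 1 N).filter (· ∈ A)).card : ℝ) / N) Filter.atTop

/-- The irrational points of the unit interval. -/
def unitIrr : Set ℝ := {x | Irrational x} ∩ Ioo 0 1

/-- The numerators of the convergents of a point of `(0,1)`. -/
noncomputable def cfP (α : ℝ) : ℕ → ℕ
  | 0 => 0
  | 1 => 1
  | (k + 2) => cfA α (k + 2) * cfP α (k + 1) + cfP α k

lemma fract_inv_mem_unitIrr {y : ℝ} (hy : y ∈ unitIrr) : Int.fract (1 / y) ∈ unitIrr := by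
  have h1 : Irrational (1 / y) := by
    rw [one_div]; exact hy.1.inv
  have h2 : Irrational (Int.fract (1 / y)) := by
    rw [Int.fract]; exact h1.sub_intCast _
  exact ⟨h2, lt_of_le_of_ne (Int.fract_nonneg _) (Ne.symm h2.ne_zero), Int.fract_lt_one _⟩

lemma gaussIter_mem_unitIrr {x : ℝ} (hx : x ∈ unitIrr) (k : ℕ) : gaussIter x k ∈ unitIrr := by
  induction k with
  | zero =>
    rw [gaussIter, Int.fract_eq_self.2 ⟨hx.2.1.le, hx.2.2⟩]; exact hx
  | succ k ih => exact fract_inv_mem_unitIrr ih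

lemma gaussIter_zero_of_mem {x : ℝ} (hx : x ∈ unitIrr) : gaussIter x 0 = x := by
  rw [gaussIter, Int.fract_eq_self.2 ⟨hx.2.1.le, hx.2.2⟩]

lemma cfA_add_gaussIter {x : ℝ} (hx : x ∈ unitIrr) (k : ℕ) :
    (cfA x (k + 1) : ℝ) + gaussIter x (k + 1) = 1 / gaussIter x k := by
  have h := (gaussIter_mem_unitIrr hx k).2.1
  rw [cfA, gaussIter, Nat.add_sub_cancel, natCast_floor_eq_intCast_floor (by positivity)]
  exact Int.floor_add_fract _

lemma one_le_cfA {x : ℝ} (hx : x ∈ unitIrr) (k : ℕ) : 1 ≤ cfA x (k + 1) := by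
  have h := (gaussIter_mem_unitIrr hx k).2
  rw [cfA, Nat.add_sub_cancel]
  apply Nat.le_floor
  rw [Nat.cast_one, le_div_iff₀ h.1]
  linarith [h.2]

lemma one_le_cfQ {x : ℝ} (hx : x ∈ unitIrr) (k : ℕ) : 1 ≤ cfQ x k := by
  induction k using Nat.strong_induction_on with
  | _ k ih =>
    match k with
    | 0 => simp [cfQ]
    | 1 => simpa [cfQ] using one_le_cfA hx 0
    | k + 2 =>
      rw [cfQ]
      have := ih k (by lia)
      lia

lemma cfQ_le_succ {x : ℝ} (hx : x ∈ unitIrr) (k : ℕ) : cfQ x k ≤ cfQ x (k + 1) := by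
  match k with
  | 0 => simpa [cfQ] using one_le_cfA hx 0
  | k + 1 =>
    rw [cfQ.eq_3]
    have := Nat.mul_le_mul_right (cfQ x (k + 1)) (one_le_cfA hx (k + 1))
    lia

lemma monotone_cfQ {x : ℝ} (hx : x ∈ unitIrr) : Monotone (cfQ x) :=
  monotone_nat_of_le_succ (cfQ_le_succ hx)

lemma two_mul_cfQ_le {x : ℝ} (hx : x ∈ unitIrr) (k : ℕ) : 2 * cfQ x k ≤ cfQ x (k + 2) := by
  rw [cfQ.eq_3]
  have := Nat.mul_le_mul_right (cfQ x (k + 1)) (one_le_cfA hx (k + 1))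
  have := cfQ_le_succ hx k
  lia

lemma two_pow_le_cfQ {x : ℝ} (hx : x ∈ unitIrr) (j : ℕ) : 2 ^ j ≤ cfQ x (2 * j) := by
  induction j with
  | zero => simp [cfQ]
  | succ j ih =>
    have := two_mul_cfQ_le hx (2 * j)
    rw [pow_succ]
    calc 2 ^ j * 2 ≤ 2 * cfQ x (2 * j) := by lia
      _ ≤ cfQ x (2 * (j + 1)) := this

lemma cfP_cfQ_det (x : ℝ) (k : ℕ) :
    (cfP x (k + 1) : ℝ) * cfQ x k - cfP x k * cfQ x (k + 1) = (-1) ^ k := by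
  induction k with
  | zero => simp [cfP, cfQ]
  | succ k ih =>
    rw [cfP.eq_3, cfQ.eq_3, pow_succ, ← ih]
    push_cast
    ring

lemma mul_cfQ_add_eq {x : ℝ} (hx : x ∈ unitIrr) (k : ℕ) :
    x * (cfQ x (k + 1) + cfQ x k * gaussIter x (k + 1)) =
      cfP x (k + 1) + cfP x k * gaussIter x (k + 1) := by
  induction k with
  | zero =>
    have h := cfA_add_gaussIter hx 0
    rw [gaussIter_zero_of_mem hx] at h
    simp only [cfQ, cfP, zero_add, Nat.cast_one, one_mul, Nat.cast_zero, zero_mul, add_zero] at h ⊢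
    rw [h, mul_one_div_cancel hx.2.1.ne']
  | succ k ih =>
    have h := cfA_add_gaussIter hx (k + 1)
    have h0 := (gaussIter_mem_unitIrr hx (k + 1)).2.1
    set y := gaussIter x (k + 1)
    have h2 : gaussIter x (k + 1 + 1) = 1 / y - cfA x (k + 1 + 1) := by linarith
    rw [h2, cfQ.eq_3, cfP.eq_3]
    push_cast
    field_simp
    linear_combination ih

/-- The signed approximation error `(-1)^k (q_k x - p_k)`. -/
noncomputable def cfErr (x : ℝ) (k : ℕ) : ℝ := (-1) ^ k * (cfQ x k * x - cfP x k)

lemma cfErr_succ {x : ℝ} (hx : x ∈ unitIrr) (k : ℕ) :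
    cfErr x (k + 1) = gaussIter x (k + 1) * cfErr x k := by
  rw [cfErr, cfErr, pow_succ]
  linear_combination (-(-1 : ℝ) ^ k) * mul_cfQ_add_eq hx k

lemma cfErr_pos {x : ℝ} (hx : x ∈ unitIrr) (k : ℕ) : 0 < cfErr x k := by
  induction k with
  | zero => simpa [cfErr, cfQ, cfP] using hx.2.1
  | succ k ih =>
    rw [cfErr_succ hx]
    exact mul_pos (gaussIter_mem_unitIrr hx _).2.1 ih

/-- A one-sided form of Legendre's theorem: a sufficiently good approximation from above is a
convergent of odd index. -/
lemma exists_odd_cfQ_eq {x : ℝ} (hx : x ∈ unitIrr) {p : ℤ} {q : ℕ} (hq : 0 < q)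
    (hpq : IsCoprime p q) (h0 : q * x < p) (h1 : p - q * x < 1 / (2 * q)) :
    ∃ k, Odd k ∧ cfQ x k = q := by
  obtain ⟨k, hk1, hk2⟩ : ∃ k, cfQ x k ≤ q ∧ q < cfQ x (k + 1) := by
    have hex : ∃ n, q < cfQ x n := ⟨2 * q, (Nat.lt_two_pow_self).trans_le (two_pow_le_cfQ hx q)⟩
    classical
    have hs := Nat.find_spec hex
    have h0 : Nat.find hex ≠ 0 := by
      intro h
      rw [h] at hs
      simp only [cfQ] at hs
      lia
    obtain ⟨k, hk⟩ := Nat.exists_eq_succ_of_ne_zero h0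
    refine ⟨k, ?_, by rw [hk] at hs; exact hs⟩
    exact not_lt.1 (Nat.find_min hex (by lia))
  have hdet : ((cfP x (k + 1) : ℤ)) * cfQ x k - cfP x k * cfQ x (k + 1) = (-1) ^ k := by
    exact_mod_cast cfP_cfQ_det x k
  have hQ1 := one_le_cfQ hx k
  have e0 := cfErr_pos hx k
  have e1 := cfErr_pos hx (k + 1)
  have hss : ((-1 : ℤ) ^ k) * (-1) ^ k = 1 := by rw [← mul_pow]; simp
  have hssR : ((-1 : ℝ) ^ k) * (-1) ^ k = 1 := by rw [← mul_pow]; simp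
  set s : ℤ := (-1) ^ k with hs
  have hsR : (-1 : ℝ) ^ k = (s : ℝ) := by rw [hs]; push_cast; rfl
  set u : ℤ := s * (q * cfP x (k + 1) - p * cfQ x (k + 1)) with hu
  set v : ℤ := s * (p * cfQ x k - q * cfP x k) with hv
  have hqe : (q : ℤ) = u * cfQ x k + v * cfQ x (k + 1) := by
    linear_combination (-(s : ℤ) * q) * hdet + (-(q : ℤ)) * hss
  have hpe : p = u * cfP x k + v * cfP x (k + 1) := by
    linear_combination (-(s : ℤ) * p) * hdet + (-p) * hss
  have hpR : (p : ℝ) = u * cfP x k + v * cfP x (k + 1) := by exact_mod_cast hpe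
  have hqR : (q : ℝ) = u * cfQ x k + v * cfQ x (k + 1) := by exact_mod_cast hqe
  have herr : (q * x - p : ℝ) = s * (u * cfErr x k - v * cfErr x (k + 1)) := by
    rw [cfErr, cfErr, pow_succ, hsR, hpR, hqR]
    rw [hsR] at hssR
    linear_combination (-(u * cfQ x k + v * cfQ x (k + 1)) * x
      + (u * cfP x k + v * cfP x (k + 1))) * hssR
  have hsabs : |(s : ℝ)| = 1 := by rw [← hsR]; simp
  by_cases hv0 : v = 0
  · rw [hv0, zero_mul, add_zero] at hqe hpe
    have hu1 : IsUnit u := by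
      have := hpq.isUnit_of_dvd' (x := u) ⟨_, hpe⟩ ⟨_, hqe⟩
      exact this
    have hupos : 0 < u := by
      by_contra hcon
      have : u * (cfQ x k : ℤ) ≤ 0 := mul_nonpos_of_nonpos_of_nonneg (not_lt.1 hcon) (by positivity)
      lia
    have hu1 : u = 1 := by
      rcases Int.isUnit_iff.1 hu1 with h | h <;> lia
    refine ⟨k, ?_, by rw [hu1] at hqe; lia⟩
    by_contra hodd
    rw [Nat.not_odd_iff_even] at hodd
    have hs1 : s = 1 := by rw [hs]; exact hodd.neg_one_pow
    rw [hv0, hs1, hu1] at herr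
    push_cast at herr
    linarith
  · exfalso
    have hkey : cfErr x k ≤ |(q * x - p : ℝ)| := by
      rw [herr, abs_mul, hsabs, one_mul]
      rcases lt_or_gt_of_ne hv0 with hneg | hpos
      · have hu0 : 1 ≤ u := by
          by_contra hcon
          have h3 : u * (cfQ x k : ℤ) ≤ 0 :=
            mul_nonpos_of_nonpos_of_nonneg (by lia) (by positivity)
          have h4 : v * (cfQ x (k + 1) : ℤ) ≤ 0 :=
            mul_nonpos_of_nonpos_of_nonneg (by lia) (by positivity)
          lia
        have h5 : (1 : ℝ) ≤ u := by exact_mod_cast hu0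
        have h6 : (v : ℝ) < 0 := by exact_mod_cast hneg
        refine le_trans ?_ (le_abs_self _)
        nlinarith
      · have hu0 : u ≤ -1 := by
          by_contra hcon
          have h3 : 0 ≤ u * (cfQ x k : ℤ) := mul_nonneg (by lia) (by positivity)
          have h4 : 1 * (cfQ x (k + 1) : ℤ) ≤ v * (cfQ x (k + 1) : ℤ) :=
            mul_le_mul_of_nonneg_right (by lia) (by positivity)
          lia
        have h5 : (u : ℝ) ≤ -1 := by exact_mod_cast hu0
        have h6 : (0 : ℝ) < v := by exact_mod_cast hpos
        refine le_trans ?_ (neg_le_abs _)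
        nlinarith
    have hlt : |(q * x - p : ℝ)| < 1 / (2 * q) := by
      rw [abs_sub_comm, abs_of_pos (by linarith)]; exact h1
    have hv1 : (1 : ℝ) ≤ |(v : ℝ)| := by
      exact_mod_cast Int.one_le_abs hv0
    have hvR : (v : ℝ) = q * cfErr x k - s * cfQ x k * (q * x - p) := by
      rw [hv, cfErr, hsR]; push_cast; ring
    have hqpos : (0 : ℝ) < q := by exact_mod_cast hq
    have hQq : (cfQ x k : ℝ) ≤ q := by exact_mod_cast hk1
    have hQ0 : (1 : ℝ) ≤ cfQ x k := by exact_mod_cast hQ1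
    have hb : |(v : ℝ)| ≤ q * cfErr x k + cfQ x k * |(q * x - p : ℝ)| := by
      rw [hvR]
      refine (abs_sub _ _).trans ?_
      rw [abs_mul, abs_mul, abs_mul, hsabs, abs_of_pos hqpos, abs_of_pos e0, one_mul,
        abs_of_nonneg (by positivity : (0 : ℝ) ≤ cfQ x k)]
    have h7 : (q : ℝ) * |(q * x - p : ℝ)| < 1 / 2 := by
      rw [lt_div_iff₀ (by positivity)] at hlt
      linarith
    nlinarith [abs_nonneg (q * x - p : ℝ)]

lemma cfP_cfQ_congr {x x' : ℝ} {k : ℕ} (h : ∀ i, 1 ≤ i → i ≤ k → cfA x i = cfA x' i) :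
    cfP x k = cfP x' k ∧ cfQ x k = cfQ x' k := by
  induction k using Nat.strong_induction_on with
  | _ k ih =>
    match k with
    | 0 => simp [cfP, cfQ]
    | 1 => simp [cfP, cfQ, h 1 le_rfl le_rfl]
    | k + 2 =>
      obtain ⟨a1, a2⟩ := ih k (by lia) (fun i h1 h2 => h i h1 (by lia))
      obtain ⟨b1, b2⟩ := ih (k + 1) (by lia) (fun i h1 h2 => h i h1 (by lia))
      rw [cfP.eq_3, cfP.eq_3, cfQ.eq_3, cfQ.eq_3, a1, a2, b1, b2, h (k + 2) (by lia) le_rfl]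
      exact ⟨rfl, rfl⟩

lemma one_div_natCast_add_mem_unitIrr {y : ℝ} (hy : y ∈ unitIrr) {a : ℕ} (ha : 1 ≤ a) :
    1 / (a + y) ∈ unitIrr := by
  have ha' : (1 : ℝ) ≤ a := by exact_mod_cast ha
  have h0 := hy.2.1
  refine ⟨?_, by positivity, ?_⟩
  · have := (hy.1.natCast_add a).inv
    rw [one_div]; exact this
  · rw [div_lt_one (by positivity)]; linarith

lemma exists_unitIrr_of_gaussIter {x₀ : ℝ} (hx₀ : x₀ ∈ unitIrr) (k : ℕ) {y : ℝ}
    (hy : y ∈ unitIrr) :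
    ∃ x ∈ unitIrr, x * (cfQ x₀ (k + 1) + cfQ x₀ k * y) = cfP x₀ (k + 1) + cfP x₀ k * y ∧
      (∀ i, 1 ≤ i → i ≤ k + 1 → cfA x i = cfA x₀ i) ∧ gaussIter x (k + 1) = y := by
  induction k generalizing y with
  | zero =>
    have ha := one_le_cfA hx₀ 0
    have hx := one_div_natCast_add_mem_unitIrr hy ha
    have hy0 := hy.2.1
    rw [zero_add] at *
    have hfl : ⌊(cfA x₀ 1 : ℝ) + y⌋₊ = cfA x₀ 1 := by
      rw [add_comm, Nat.floor_add_natCast hy0.le, Nat.floor_eq_zero.2 hy.2.2, zero_add]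
    refine ⟨_, hx, ?_, ?_, ?_⟩
    · simp only [cfQ, cfP, Nat.cast_one, Nat.cast_zero, zero_mul, one_mul, add_zero]
      rw [one_div_mul_cancel (by positivity)]
    · intro i h1 h2
      obtain rfl : i = 1 := by lia
      rw [cfA, Nat.sub_self, gaussIter_zero_of_mem hx, one_div_one_div, hfl]
    · rw [gaussIter, gaussIter_zero_of_mem hx, one_div_one_div, Int.fract_natCast_add,
        Int.fract_eq_self.2 ⟨hy0.le, hy.2.2⟩]
  | succ k ih =>
    have ha := one_le_cfA hx₀ (k + 1)
    have hy' := one_div_natCast_add_mem_unitIrr hy ha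
    have hy0 := hy.2.1
    obtain ⟨x, hx, h1, h2, h3⟩ := ih hy'
    have hfl : ⌊(cfA x₀ (k + 1 + 1) : ℝ) + y⌋₊ = cfA x₀ (k + 1 + 1) := by
      rw [add_comm, Nat.floor_add_natCast hy0.le, Nat.floor_eq_zero.2 hy.2.2, zero_add]
    refine ⟨x, hx, ?_, ?_, ?_⟩
    · have hpos : (0 : ℝ) < cfA x₀ (k + 1 + 1) + y := by positivity
      rw [cfQ.eq_3, cfP.eq_3]
      push_cast
      field_simp at h1
      linear_combination h1
    · intro i hi1 hi2
      rcases Nat.lt_or_ge i (k + 2) with h | h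
      · exact h2 i hi1 (by lia)
      · obtain rfl : i = k + 1 + 1 := by lia
        rw [cfA, Nat.add_sub_cancel, h3, one_div_one_div, hfl]
    · rw [gaussIter, h3, one_div_one_div, Int.fract_natCast_add,
        Int.fract_eq_self.2 ⟨hy0.le, hy.2.2⟩]

/-- The points of the unit interval sharing the first `k` partial quotients of `x₀`. -/
def cfCylinder (x₀ : ℝ) (k : ℕ) : Set ℝ :=
  {x | x ∈ unitIrr ∧ ∀ i, 1 ≤ i → i ≤ k → cfA x i = cfA x₀ i}

lemma cfCylinder_inter_eq {x₀ : ℝ} (hx₀ : x₀ ∈ unitIrr) (k : ℕ) {s : ℝ} (hs0 : 0 < s)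
    (hs1 : s ≤ 1) :
    cfCylinder x₀ (k + 1) ∩ {x | gaussIter x (k + 1) < s} =
      {x | Irrational x} ∩ {x | (-1) ^ k * (cfP x₀ (k + 1) / cfQ x₀ (k + 1) - x) ∈
        Ioo 0 (s / (cfQ x₀ (k + 1) * (cfQ x₀ (k + 1) + cfQ x₀ k * s)) : ℝ)} := by
  have hq : (0 : ℝ) < cfQ x₀ (k + 1) := by exact_mod_cast one_le_cfQ hx₀ (k + 1)
  have hq' : (0 : ℝ) < cfQ x₀ k := by exact_mod_cast one_le_cfQ hx₀ k
  have hdet := cfP_cfQ_det x₀ k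
  have hss : ((-1 : ℝ) ^ k) * (-1) ^ k = 1 := by rw [← mul_pow]; simp
  have hsne : ((-1 : ℝ) ^ k) ≠ 0 := by simp
  set q := (cfQ x₀ (k + 1) : ℝ)
  set q' := (cfQ x₀ k : ℝ)
  set p := (cfP x₀ (k + 1) : ℝ)
  set p' := (cfP x₀ k : ℝ)
  set e := (-1 : ℝ) ^ k
  have hval : ∀ {x y : ℝ}, 0 < y → x * (q + q' * y) = p + p' * y →
      e * (p / q - x) = y / (q * (q + q' * y)) := by
    intro x y hy h
    have hx : x = (p + p' * y) / (q + q' * y) := by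
      rw [eq_div_iff (by positivity)]; exact h
    rw [hx]
    field_simp
    linear_combination (e * y) * hdet + y * hss
  ext x
  constructor
  · rintro ⟨⟨hx, hagree⟩, hlt⟩
    have hy := gaussIter_mem_unitIrr hx (k + 1)
    have hc := cfP_cfQ_congr hagree
    have hc' := cfP_cfQ_congr (k := k) (fun i h1 h2 => hagree i h1 (by lia))
    have hm := mul_cfQ_add_eq hx k
    rw [hc.1, hc.2, hc'.1, hc'.2] at hm
    refine ⟨hx.1, ?_⟩
    have hy0 := hy.2.1
    change gaussIter x (k + 1) < s at hlt
    rw [mem_ofPred_eq, hval hy0 hm]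
    refine ⟨by positivity, ?_⟩
    rw [div_lt_div_iff₀ (by positivity) (by positivity)]
    nlinarith [mul_pos hq hq]
  · rintro ⟨hirr, h0, h1⟩
    set u := e * (p / q - x) with hu
    have hxu : x = p / q - e * u := by
      rw [hu]; linear_combination (p / q - x) * hss
    rw [lt_div_iff₀ (by positivity)] at h1
    have hden : 0 < 1 - q * q' * u := by
      by_contra hcon
      have : 0 ≤ (q * q' * u - 1) * s := mul_nonneg (by linarith) hs0.le
      nlinarith [mul_pos h0 (mul_pos hq hq)]
    set y := u * q ^ 2 / (1 - q * q' * u) with hy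
    have hy0 : 0 < y := by positivity
    have hys : y < s := by
      rw [hy, div_lt_iff₀ hden]
      nlinarith
    have hne : q + q' * y ≠ 0 := by positivity
    have hrel : x * (q + q' * y) = p + p' * y := by
      have hyd : y * (1 - q * q' * u) = u * q ^ 2 := div_mul_cancel₀ _ hden.ne'
      have hxq : x * q = p - e * u * q := by
        rw [hxu, sub_mul, div_mul_cancel₀ _ hq.ne']
      apply mul_right_cancel₀ hq.ne'
      linear_combination (q + q' * y) * hxq + y * hdet + e * hyd
    have hyirr : Irrational y := by
      rintro ⟨r, hr⟩
      apply hirr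
      refine ⟨(cfP x₀ (k + 1) + cfP x₀ k * r) / (cfQ x₀ (k + 1) + cfQ x₀ k * r), ?_⟩
      push_cast
      rw [hr, div_eq_iff hne]
      exact hrel.symm
    obtain ⟨z, hz, hz1, hz2, hz3⟩ :=
      exists_unitIrr_of_gaussIter hx₀ k (y := y) ⟨hyirr, hy0, hys.trans_le hs1⟩
    have hzx : z = x := mul_right_cancel₀ hne (hz1.trans hrel.symm)
    subst hzx
    exact ⟨⟨hz, hz2⟩, by rw [mem_ofPred_eq, hz3]; exact hys⟩

lemma volume_inter_irrational (S : Set ℝ) : volume ({x | Irrational x} ∩ S) = volume S := by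
  have h : volume ({x : ℝ | Irrational x}ᶜ) = 0 := by
    have : ({x : ℝ | Irrational x}ᶜ) = Set.range ((↑) : ℚ → ℝ) := by
      ext x; simp [Irrational]
    rw [this]
    exact (Set.countable_range _).measure_zero _
  rw [inter_comm]
  exact measure_inter_conull h

lemma volume_cfCylinder_inter {x₀ : ℝ} (hx₀ : x₀ ∈ unitIrr) (k : ℕ) {s : ℝ} (hs0 : 0 < s)
    (hs1 : s ≤ 1) :
    volume (cfCylinder x₀ (k + 1) ∩ {x | gaussIter x (k + 1) < s}) =
      ENNReal.ofReal (s / (cfQ x₀ (k + 1) * (cfQ x₀ (k + 1) + cfQ x₀ k * s))) := by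
  rw [cfCylinder_inter_eq hx₀ k hs0 hs1, volume_inter_irrational]
  set c := (cfP x₀ (k + 1) / cfQ x₀ (k + 1) : ℝ)
  set w := (s / (cfQ x₀ (k + 1) * (cfQ x₀ (k + 1) + cfQ x₀ k * s)) : ℝ)
  rcases neg_one_pow_eq_or ℝ k with h | h
  · have : {x | (-1) ^ k * (c - x) ∈ Ioo 0 w} = Ioo (c - w) c := by
      ext x; rw [h]; simp only [mem_ofPred_eq, mem_Ioo]
      constructor <;> rintro ⟨h1, h2⟩ <;> constructor <;> linarith
    rw [this, Real.volume_Ioo]; congr 1; ring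
  · have : {x | (-1) ^ k * (c - x) ∈ Ioo 0 w} = Ioo c (c + w) := by
      ext x; rw [h]; simp only [mem_ofPred_eq, mem_Ioo]
      constructor <;> rintro ⟨h1, h2⟩ <;> constructor <;> linarith
    rw [this, Real.volume_Ioo]; congr 1; ring

lemma cfCylinder_inter_lt_one (x₀ : ℝ) (k : ℕ) :
    cfCylinder x₀ k ∩ {x | gaussIter x k < 1} = cfCylinder x₀ k :=
  inter_eq_left.2 fun _ hx => (gaussIter_mem_unitIrr hx.1 k).2.2

lemma volume_cfCylinder {x₀ : ℝ} (hx₀ : x₀ ∈ unitIrr) (k : ℕ) :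
    volume (cfCylinder x₀ (k + 1)) =
      ENNReal.ofReal (1 / (cfQ x₀ (k + 1) * (cfQ x₀ (k + 1) + cfQ x₀ k * 1))) := by
  rw [← cfCylinder_inter_lt_one, volume_cfCylinder_inter hx₀ k one_pos le_rfl]

lemma le_volume_cfCylinder_inter {x₀ : ℝ} (hx₀ : x₀ ∈ unitIrr) (k : ℕ) {s : ℝ} (hs0 : 0 < s)
    (hs1 : s ≤ 1) :
    ENNReal.ofReal s * volume (cfCylinder x₀ (k + 1)) ≤
      volume (cfCylinder x₀ (k + 1) ∩ {x | gaussIter x (k + 1) < s}) := by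
  have hq : (0 : ℝ) < cfQ x₀ (k + 1) := by exact_mod_cast one_le_cfQ hx₀ (k + 1)
  have hq' : (0 : ℝ) < cfQ x₀ k := by exact_mod_cast one_le_cfQ hx₀ k
  rw [volume_cfCylinder hx₀, volume_cfCylinder_inter hx₀ k hs0 hs1, ← ENNReal.ofReal_mul hs0.le]
  apply ENNReal.ofReal_le_ofReal
  rw [mul_one_div]
  gcongr

lemma volume_cfCylinder_inter_le {x₀ : ℝ} (hx₀ : x₀ ∈ unitIrr) (k : ℕ) {s : ℝ} (hs0 : 0 < s)
    (hs1 : s ≤ 1) :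
    volume (cfCylinder x₀ (k + 1) ∩ {x | gaussIter x (k + 1) < s}) ≤
      ENNReal.ofReal (2 * s) * volume (cfCylinder x₀ (k + 1)) := by
  have hq : (0 : ℝ) < cfQ x₀ (k + 1) := by exact_mod_cast one_le_cfQ hx₀ (k + 1)
  have hq' : (0 : ℝ) < cfQ x₀ k := by exact_mod_cast one_le_cfQ hx₀ k
  have hqq : (cfQ x₀ k : ℝ) ≤ cfQ x₀ (k + 1) := by exact_mod_cast cfQ_le_succ hx₀ k
  rw [volume_cfCylinder hx₀, volume_cfCylinder_inter hx₀ k hs0 hs1,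
    ← ENNReal.ofReal_mul (by positivity)]
  apply ENNReal.ofReal_le_ofReal
  rw [mul_one_div, div_le_div_iff₀ (by positivity) (by positivity)]
  set q := (cfQ x₀ (k + 1) : ℝ)
  set q' := (cfQ x₀ k : ℝ)
  have : q + q' * 1 ≤ 2 * (q + q' * s) := by nlinarith [mul_pos hq' hs0]
  calc s * (q * (q + q' * 1)) ≤ s * (q * (2 * (q + q' * s))) := by gcongr
    _ = 2 * s * (q * (q + q' * s)) := by ring

lemma measurable_gaussIter (k : ℕ) : Measurable fun x => gaussIter x k := by
  induction k with
  | zero => exact measurable_fract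
  | succ k ih => exact (measurable_const.div ih).fract

lemma measurable_cfA (k : ℕ) : Measurable fun x => cfA x k :=
  (measurable_const.div (measurable_gaussIter _)).nat_floor

lemma measurable_cfQ (k : ℕ) : Measurable fun x => cfQ x k := by
  induction k using Nat.strong_induction_on with
  | _ k ih =>
    match k with
    | 0 => simp only [cfQ]; exact measurable_const
    | 1 => simp only [cfQ]; exact measurable_cfA 1
    | k + 2 =>
      simp only [cfQ]
      exact ((measurable_cfA _).mul (ih _ (by lia))).add (ih _ (by lia))

lemma measurableSet_unitIrr : MeasurableSet unitIrr := by
  have : {x : ℝ | Irrational x} = (Set.range ((↑) : ℚ → ℝ))ᶜ := by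
    ext x; simp [Irrational]
  rw [unitIrr, this]
  exact (Set.countable_range _).measurableSet.compl.inter measurableSet_Ioo

lemma volume_unitIrr : volume unitIrr = 1 := by
  rw [unitIrr, volume_inter_irrational]; simp

/-- The vector of the first `k` partial quotients. -/
noncomputable def cfCode (k : ℕ) (x : ℝ) : Fin k → ℕ := fun i => cfA x (i + 1)

lemma measurable_cfCode (k : ℕ) : Measurable (cfCode k) :=
  measurable_pi_lambda _ fun _ => measurable_cfA _

lemma cfCylinder_eq (x₀ : ℝ) (k : ℕ) :
    cfCylinder x₀ k = unitIrr ∩ cfCode k ⁻¹' {cfCode k x₀} := by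
  ext x
  refine and_congr_right fun _ => ?_
  simp only [mem_preimage, mem_singleton_iff, funext_iff, cfCode, Fin.forall_iff]
  constructor
  · intro h i hi
    exact h _ (by lia) (by lia)
  · intro h i h1 h2
    have := h (i - 1) (by lia)
    rwa [Nat.sub_add_cancel h1] at this

lemma tsum_volume_cfCode {k : ℕ} (S : Set ℝ) (B : Set (Fin k → ℕ)) :
    ∑' b : B, volume (cfCode k ⁻¹' {b.1} ∩ S) = volume (cfCode k ⁻¹' B ∩ S) := by
  have := tsum_measure_preimage_singleton (μ := volume.restrict S) (s := B) B.to_countable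
    (f := cfCode k) (fun y _ => measurable_cfCode k (measurableSet_singleton y))
  rw [Measure.restrict_apply (measurable_cfCode k B.to_countable.measurableSet)] at this
  rw [← this]
  refine tsum_congr fun b => ?_
  rw [Measure.restrict_apply (measurable_cfCode k (measurableSet_singleton _))]

lemma measurableSet_gaussIter_lt (k : ℕ) (s : ℝ) : MeasurableSet {x | gaussIter x k < s} :=
  measurableSet_lt (measurable_gaussIter k) measurable_const

/-- Conditionally on the first `k + 1` partial quotients, the Gauss iterate is below `s` with
probability at least `s`. -/
lemma le_volume_inter_gaussIter_lt {k : ℕ} {G : Set ℝ} (hG : G ⊆ unitIrr)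
    (hsat : ∀ x ∈ G, cfCylinder x (k + 1) ⊆ G) {s : ℝ} (hs0 : 0 < s) (hs1 : s ≤ 1) :
    MeasurableSet G ∧
      ENNReal.ofReal s * volume G ≤ volume (G ∩ {x | gaussIter x (k + 1) < s}) := by
  have hGeq : G = cfCode (k + 1) ⁻¹' (cfCode (k + 1) '' G) ∩ unitIrr := by
    refine Subset.antisymm (fun x hx => ⟨mem_image_of_mem _ hx, hG hx⟩) ?_
    rintro x ⟨⟨z, hz, hzx⟩, hx⟩
    apply hsat z hz
    rw [cfCylinder_eq]
    exact ⟨hx, hzx.symm⟩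
  set B := cfCode (k + 1) '' G with hB
  refine ⟨?_, ?_⟩
  · rw [hGeq]
    exact (measurable_cfCode _ B.to_countable.measurableSet).inter measurableSet_unitIrr
  · rw [hGeq, inter_assoc, ← tsum_volume_cfCode unitIrr,
      ← tsum_volume_cfCode (unitIrr ∩ _),
      ← ENNReal.tsum_mul_left]
    refine ENNReal.tsum_le_tsum fun b => ?_
    obtain ⟨z, hz, hzb⟩ := b.2
    have := le_volume_cfCylinder_inter (hG hz) k hs0 hs1
    rwa [cfCylinder_eq, hzb, inter_comm unitIrr, inter_assoc] at this

lemma volume_gaussIter_lt_le (k : ℕ) {s : ℝ} (hs0 : 0 < s) (hs1 : s ≤ 1) :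
    volume (unitIrr ∩ {x | gaussIter x k < s}) ≤ ENNReal.ofReal (2 * s) := by
  match k with
  | 0 =>
    calc volume (unitIrr ∩ {x | gaussIter x 0 < s}) ≤ volume (Ioo 0 s) := by
          apply measure_mono
          rintro x ⟨hx, hxs⟩
          rw [mem_ofPred_eq, gaussIter_zero_of_mem hx] at hxs
          exact ⟨hx.2.1, hxs⟩
      _ ≤ ENNReal.ofReal (2 * s) := by
          rw [Real.volume_Ioo]
          apply ENNReal.ofReal_le_ofReal; linarith
  | k + 1 =>
    set B := cfCode (k + 1) '' unitIrr with hB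
    have hsub : unitIrr ⊆ cfCode (k + 1) ⁻¹' B := fun x hx => mem_image_of_mem _ hx
    have h1 := tsum_volume_cfCode unitIrr B
    have h2 := tsum_volume_cfCode (unitIrr ∩ {x | gaussIter x (k + 1) < s}) B
    rw [inter_eq_right.2 hsub, volume_unitIrr] at h1
    rw [inter_eq_right.2 (inter_subset_left.trans hsub)] at h2
    rw [← h2, ← mul_one (ENNReal.ofReal _), ← h1, ← ENNReal.tsum_mul_left]
    refine ENNReal.tsum_le_tsum fun b => ?_
    obtain ⟨z, hz, hzb⟩ := b.2
    have := volume_cfCylinder_inter_le hz k hs0 hs1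
    rwa [cfCylinder_eq, hzb, inter_comm unitIrr, inter_assoc] at this

lemma gaussIter_lt_of_le_cfA {x : ℝ} (hx : x ∈ unitIrr) {k j : ℕ} (hj : 1 ≤ j)
    (h : j ≤ cfA x (k + 1)) : gaussIter x k < 1 / j := by
  obtain ⟨hirr, h0, -⟩ := gaussIter_mem_unitIrr hx k
  have hj' : (0 : ℝ) < j := by exact_mod_cast hj
  rw [cfA, Nat.add_sub_cancel, Nat.le_floor_iff (by positivity)] at h
  refine lt_of_le_of_ne ?_ ?_
  · rw [le_div_iff₀ hj']
    rw [le_div_iff₀ h0] at h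
    linarith
  · intro he
    apply hirr
    exact ⟨1 / j, by rw [he]; push_cast; rfl⟩

lemma volume_le_cfA_le (k : ℕ) {j : ℕ} (hj : 1 ≤ j) :
    volume (unitIrr ∩ {x | j ≤ cfA x (k + 1)}) ≤ ENNReal.ofReal (2 / j) := by
  have hj' : (1 : ℝ) ≤ j := by exact_mod_cast hj
  have h := volume_gaussIter_lt_le k (s := 1 / j) (by positivity)
    (by rw [div_le_one (by positivity)]; exact hj')
  rw [mul_one_div] at h
  refine (measure_mono ?_).trans h
  exact fun x hx => ⟨hx.1, gaussIter_lt_of_le_cfA hx.1 hj hx.2⟩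

lemma lintegral_min_cfA_le (k T : ℕ) :
    ∫⁻ x in unitIrr, (min (cfA x (k + 1)) T : ℕ) ≤
      ENNReal.ofReal (2 * (1 + Real.log T)) := by
  have hpt : ∀ x, ((min (cfA x (k + 1)) T : ℕ) : ENNReal) =
      ∑ j ∈ Finset.Icc 1 T, {x | j ≤ cfA x (k + 1)}.indicator 1 x := by
    intro x
    have : ∀ j, ({x | j ≤ cfA x (k + 1)}.indicator 1 x : ENNReal) =
        ((if j ≤ cfA x (k + 1) then 1 else 0 : ℕ) : ENNReal) := by
      intro j; by_cases h : j ≤ cfA x (k + 1) <;> simp [h]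
    simp_rw [this]
    rw [← Nat.cast_sum, ← Finset.card_filter]
    congr 1
    have : (Finset.Icc 1 T).filter (fun j => j ≤ cfA x (k + 1)) =
        Finset.Icc 1 (min (cfA x (k + 1)) T) := by
      ext j; simp only [Finset.mem_filter, Finset.mem_Icc, le_min_iff]; tauto
    rw [this, Nat.card_Icc, Nat.add_sub_cancel]
  have hmeas : ∀ j : ℕ, MeasurableSet {x | j ≤ cfA x (k + 1)} := fun j =>
    measurableSet_le measurable_const (measurable_cfA _)
  simp_rw [hpt]
  rw [lintegral_finsetSum _ fun j _ => measurable_one.indicator (hmeas j)]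
  calc ∑ j ∈ Finset.Icc 1 T, ∫⁻ x in unitIrr, {x | j ≤ cfA x (k + 1)}.indicator 1 x
      ≤ ∑ j ∈ Finset.Icc 1 T, ENNReal.ofReal (2 / j) := by
        refine Finset.sum_le_sum fun j hj => ?_
        rw [lintegral_indicator_one (hmeas j), Measure.restrict_apply (hmeas j), inter_comm]
        exact volume_le_cfA_le k (Finset.mem_Icc.1 hj).1
    _ = ENNReal.ofReal (∑ j ∈ Finset.Icc 1 T, 2 / (j : ℝ)) := by
        rw [ENNReal.ofReal_sum_of_nonneg]; intros; positivity
    _ ≤ ENNReal.ofReal (2 * (1 + Real.log T)) := by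
        apply ENNReal.ofReal_le_ofReal
        have h := harmonic_le_one_add_log T
        rw [harmonic_eq_sum_Icc] at h
        push_cast at h
        calc ∑ j ∈ Finset.Icc 1 T, 2 / (j : ℝ) = 2 * ∑ j ∈ Finset.Icc 1 T, (j : ℝ)⁻¹ := by
              rw [Finset.mul_sum]; rfl
          _ ≤ _ := by gcongr

lemma volume_lt_sum_cfA_le (K : ℕ) {T : ℕ} (hT : 1 ≤ T) {t : ℝ} (ht : 0 < t) :
    volume (unitIrr ∩ {x | t < ∑ i ∈ Finset.Icc 1 K, (cfA x i : ℝ)}) ≤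
      ENNReal.ofReal (K * (2 / T) + K * (2 * (1 + Real.log T)) / t) := by
  have hT' : (1 : ℝ) ≤ T := by exact_mod_cast hT
  have hlog := Real.log_nonneg hT'
  set f : ℝ → ENNReal := fun x => ∑ i ∈ Finset.range K, ((min (cfA x (i + 1)) T : ℕ) : ENNReal)
    with hf
  have hcover : unitIrr ∩ {x | t < ∑ i ∈ Finset.Icc 1 K, (cfA x i : ℝ)} ⊆
      (⋃ i ∈ Finset.range K, unitIrr ∩ {x | T ≤ cfA x (i + 1)}) ∪
        ({x | ENNReal.ofReal t ≤ f x} ∩ unitIrr) := by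
    rintro x ⟨hx, hxt⟩
    by_cases h : ∃ i ∈ Finset.range K, T ≤ cfA x (i + 1)
    · left
      obtain ⟨i, hi, hi'⟩ := h
      exact mem_biUnion (x := i) hi ⟨hx, hi'⟩
    · right
      push Not at h
      refine ⟨?_, hx⟩
      have h2 : ∑ i ∈ Finset.Icc 1 K, (cfA x i : ℝ) =
          ∑ i ∈ Finset.range K, (cfA x (i + 1) : ℝ) := by
        rw [Finset.range_eq_Ico, Finset.sum_Ico_add' (fun i => (cfA x i : ℝ)) 0 K 1]
        rfl
      have h3 : f x = ENNReal.ofReal (∑ i ∈ Finset.range K, (cfA x (i + 1) : ℝ)) := by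
        rw [hf, ENNReal.ofReal_sum_of_nonneg fun _ _ => by positivity]
        refine Finset.sum_congr rfl fun i hi => ?_
        rw [min_eq_left (h i hi).le, ENNReal.ofReal_natCast]
      rw [mem_ofPred_eq, h3]
      rw [mem_ofPred_eq, h2] at hxt
      exact ENNReal.ofReal_le_ofReal hxt.le
  have hmin : ∀ i, Measurable fun x => ((min (cfA x (i + 1)) T : ℕ) : ENNReal) := fun i =>
    (measurable_of_countable (fun n : ℕ => (n : ENNReal))).comp
      ((measurable_cfA (i + 1)).min measurable_const)
  have hfm : Measurable f := Finset.measurable_fun_sum _ fun i _ => hmin i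
  have hint : ∫⁻ x in unitIrr, f x ≤ ENNReal.ofReal (K * (2 * (1 + Real.log T))) := by
    rw [hf, lintegral_finsetSum _ fun i _ => hmin i]
    refine (Finset.sum_le_sum fun i _ => lintegral_min_cfA_le i T).trans_eq ?_
    rw [Finset.sum_const, Finset.card_range, nsmul_eq_mul, ENNReal.ofReal_mul K.cast_nonneg,
      ENNReal.ofReal_natCast]
  refine (measure_mono hcover).trans ((measure_union_le _ _).trans ?_)
  rw [ENNReal.ofReal_add (by positivity) (by positivity)]
  gcongr
  · refine (measure_biUnion_finset_le _ _).trans ?_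
    refine (Finset.sum_le_sum fun i _ => volume_le_cfA_le i hT).trans_eq ?_
    rw [Finset.sum_const, Finset.card_range, nsmul_eq_mul, ENNReal.ofReal_mul K.cast_nonneg,
      ENNReal.ofReal_natCast]
  · rw [← Measure.restrict_apply (measurableSet_le measurable_const hfm),
      ENNReal.ofReal_div_of_pos ht]
    rw [ENNReal.le_div_iff_mul_le (by simp [ht]) (by simp), mul_comm]
    exact (mul_meas_ge_le_lintegral hfm _).trans hint

/-- The sum of the first `κ m` partial quotients is `O(m log m)` in probability. -/
lemma exists_eventually_volume_lt_sum_cfA_le (κ : ℕ) {ε : ℝ} (hε : 0 < ε) :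
    ∃ C : ℝ, 0 < C ∧ ∀ᶠ m : ℕ in atTop,
      volume (unitIrr ∩ {x | C * (m * Real.log m) < ∑ i ∈ Finset.Icc 1 (κ * m), (cfA x i : ℝ)}) ≤
        ENNReal.ofReal ε := by
  have hC : 0 < 16 * (κ + 1 : ℝ) / ε := by positivity
  refine ⟨16 * (κ + 1) / ε, hC, ?_⟩
  filter_upwards [eventually_ge_atTop 2, eventually_ge_atTop ⌈4 * (κ + 1 : ℝ) / ε⌉₊]
    with m hm2 hm
  have hm' : (2 : ℝ) ≤ m := by exact_mod_cast hm2
  have hlog : 1 / 2 ≤ Real.log m := by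
    have h1 := Real.log_le_log (by norm_num) hm'
    have h2 := Real.log_two_gt_d9
    linarith
  have hlog0 : 0 < Real.log m := by linarith
  have hmε := (Nat.ceil_le.1 hm)
  have hm0 : (0 : ℝ) < m := by linarith
  refine (volume_lt_sum_cfA_le (κ * m) (T := m ^ 2) (Nat.one_le_pow _ _ (by lia))
    (by positivity)).trans (ENNReal.ofReal_le_ofReal ?_)
  have e1 : ((κ * m : ℕ) : ℝ) * (2 / (m ^ 2 : ℕ)) ≤ ε / 2 := by
    push_cast
    rw [div_le_iff₀ hε] at hmε
    rw [show (κ : ℝ) * m * (2 / m ^ 2) = 2 * κ / m by field_simp, div_le_iff₀ hm0]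
    linarith
  have e2 : ((κ * m : ℕ) : ℝ) * (2 * (1 + Real.log (m ^ 2 : ℕ))) /
      (16 * (κ + 1) / ε * (m * Real.log m)) ≤ ε / 2 := by
    push_cast
    rw [Real.log_pow, div_le_iff₀ (by positivity)]
    rw [show ε / 2 * (16 * (κ + 1) / ε * (m * Real.log m)) = (κ + 1) * m * (2 * (4 * Real.log m)) by
      field_simp; ring]
    push_cast
    gcongr
    · linarith
    · linarith
  linarith

lemma exp_neg_le_totient_div {q : ℕ} (hq : q ≠ 0) :
    Real.exp (-(2 * ∑ p ∈ q.primeFactors, (1 / p : ℝ))) * q ≤ q.totient := by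
  have h : (q.totient : ℝ) = q * ∏ p ∈ q.primeFactors, (1 - (p : ℝ)⁻¹) := by
    have := congrArg (Rat.cast : ℚ → ℝ) (Nat.totient_eq_mul_prod_factors q)
    push_cast at this
    exact this
  rw [h, mul_comm, Finset.mul_sum, ← Finset.sum_neg_distrib, Real.exp_sum]
  gcongr with p hp
  have hp2 : (2 : ℝ) ≤ p := by exact_mod_cast (Nat.prime_of_mem_primeFactors hp).two_le
  have hx0 : 0 < (p : ℝ)⁻¹ := by positivity
  have hx1 : (p : ℝ)⁻¹ ≤ 1 / 2 := by
    rw [inv_le_comm₀ (by linarith) (by norm_num)]; linarith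
  rw [one_div, Real.exp_neg]
  set x := (p : ℝ)⁻¹
  have h1 := Real.add_one_le_exp (2 * x)
  rw [inv_le_iff_one_le_mul₀ (Real.exp_pos _)]
  nlinarith

lemma sum_sum_primeFactors_le (N : ℕ) :
    ∑ q ∈ Finset.Icc 1 N, ∑ p ∈ q.primeFactors, (1 / p : ℝ) ≤ N := by
  have hN : (0 : ℝ) ≤ N := N.cast_nonneg
  have hsq : ∑ d ∈ Finset.Ioc 1 N, (1 / (d : ℝ) ^ 2) ≤ 1 := by
    have := sum_Ioc_inv_sq_le_sub (α := ℝ) (k := 1) (n := max N 1) one_ne_zero (le_max_right _ _)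
    have h2 : Finset.Ioc 1 N = Finset.Ioc 1 (max N 1) := by
      ext; simp only [Finset.mem_Ioc]; lia
    rw [h2]
    simp only [one_div]
    refine this.trans ?_
    have : (0 : ℝ) ≤ ((max N 1 : ℕ) : ℝ)⁻¹ := by positivity
    simp only [Nat.cast_one, inv_one]
    linarith
  calc ∑ q ∈ Finset.Icc 1 N, ∑ p ∈ q.primeFactors, (1 / p : ℝ)
      ≤ ∑ q ∈ Finset.Icc 1 N, ∑ d ∈ Finset.Ioc 1 N, if d ∣ q then (1 / d : ℝ) else 0 := by
        refine Finset.sum_le_sum fun q hq => ?_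
        rw [← Finset.sum_filter]
        refine Finset.sum_le_sum_of_subset_of_nonneg (fun p hp => ?_) fun _ _ _ => by positivity
        have h1 := (Nat.prime_of_mem_primeFactors hp).two_le
        have h2 := Nat.dvd_of_mem_primeFactors hp
        have h3 := Finset.mem_Icc.1 hq
        have h4 := Nat.le_of_dvd (by lia) h2
        simp only [Finset.mem_filter, Finset.mem_Ioc]
        exact ⟨⟨by lia, by lia⟩, h2⟩
    _ = ∑ d ∈ Finset.Ioc 1 N, (N / d : ℕ) * (1 / d : ℝ) := by
        rw [Finset.sum_comm]
        refine Finset.sum_congr rfl fun d _ => ?_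
        rw [← Finset.sum_filter, Finset.sum_const, nsmul_eq_mul, ← Nat.Ioc_filter_dvd_card_eq_div]
        rfl
    _ ≤ ∑ d ∈ Finset.Ioc 1 N, N * (1 / (d : ℝ) ^ 2) := by
        refine Finset.sum_le_sum fun d _ => ?_
        calc ((N / d : ℕ) : ℝ) * (1 / d : ℝ) ≤ (N / d : ℝ) * (1 / d) := by
              gcongr; exact Nat.cast_div_le
          _ = N * (1 / (d : ℝ) ^ 2) := by ring
    _ ≤ N := by
        rw [← Finset.mul_sum]; nlinarith

/-- Up to a small proportion of exceptions, `φ(q)/q` is bounded below. -/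
lemma exists_card_totient_lt_le {κ : ℝ} (hκ : 0 < κ) :
    ∃ θ : ℝ, 0 < θ ∧ ∀ N : ℕ,
      (((Finset.Icc 1 N).filter fun q : ℕ => (q.totient : ℝ) < θ * q).card : ℝ) ≤ κ * N := by
  refine ⟨Real.exp (-(2 * (1 / κ))), Real.exp_pos _, fun N => ?_⟩
  set F := (Finset.Icc 1 N).filter fun q : ℕ => (q.totient : ℝ) < Real.exp (-(2 * (1 / κ))) * q
  have h1 : ∑ q ∈ F, (1 / κ) ≤ N := by
    refine le_trans ?_ (sum_sum_primeFactors_le N)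
    refine (Finset.sum_le_sum (g := fun q : ℕ => ∑ p ∈ q.primeFactors, (1 / p : ℝ))
      fun q hq => ?_).trans
      (Finset.sum_le_sum_of_subset_of_nonneg (Finset.filter_subset _ _)
        fun _ _ _ => Finset.sum_nonneg fun _ _ => by positivity)
    obtain ⟨hq1, hq2⟩ := Finset.mem_filter.1 hq
    by_contra hcon
    have h3 := exp_neg_le_totient_div (q := q) (by have := Finset.mem_Icc.1 hq1; lia)
    refine absurd (hq2.trans_le ((mul_le_mul_of_nonneg_right ?_ q.cast_nonneg).trans h3))
      (lt_irrefl _)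
    apply Real.exp_le_exp.2
    linarith
  rw [Finset.sum_const, nsmul_eq_mul, mul_one_div, div_le_iff₀ hκ] at h1
  linarith

lemma card_divisors_le_add_div (q : ℕ) {L : ℕ} (hL : 0 < L) : q.divisors.card ≤ L + q / L := by
  rw [← Finset.card_filter_add_card_filter_not (s := q.divisors) (fun d => d ≤ L)]
  gcongr
  · calc _ ≤ (Finset.Icc 1 L).card := by
          refine Finset.card_le_card fun d hd => ?_
          rw [Finset.mem_filter] at hd
          exact Finset.mem_Icc.2 ⟨Nat.pos_of_mem_divisors hd.1, hd.2⟩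
      _ = L := by simp
  · calc _ ≤ (Finset.Icc 1 (q / L)).card := by
          refine Finset.card_le_card_of_injOn (fun d => q / d) (fun d hd => ?_)
            fun d hd e he hde => ?_
          · obtain ⟨h1, h2⟩ := Finset.mem_filter.1 (Finset.mem_coe.1 hd)
            have h3 := Nat.divisor_le h1
            refine Finset.mem_coe.2 (Finset.mem_Icc.2 ⟨?_, Nat.div_le_div_left (by lia) hL⟩)
            exact Nat.div_pos h3 (by lia)
          · obtain ⟨h1, h2⟩ := Nat.mem_divisors.1 (Finset.mem_filter.1 (Finset.mem_coe.1 hd)).1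
            obtain ⟨h3, -⟩ := Nat.mem_divisors.1 (Finset.mem_filter.1 (Finset.mem_coe.1 he)).1
            rw [← Nat.div_div_self h1 h2, ← Nat.div_div_self h3 h2]
            exact congrArg (q / ·) hde
      _ = q / L := by simp

lemma abs_card_filter_dvd_sub_le {x y : ℝ} (hxy : x ≤ y) {d : ℕ} (hd : 0 < d) :
    |(((Finset.Ioc ⌊x⌋ ⌊y⌋).filter fun p => (d : ℤ) ∣ p).card : ℝ) - (y - x) / d| ≤ 1 := by
  have hd' : (0 : ℝ) < d := by exact_mod_cast hd
  have hfl : ∀ z : ℝ, ⌊(⌊z⌋ : ℚ) / ((d : ℤ) : ℚ)⌋ = ⌊z / d⌋ := by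
    intro z
    rw [Int.cast_natCast, Rat.floor_intCast_div_natCast, Int.floor_div_natCast]
  have h := Int.Ioc_filter_dvd_card ⌊x⌋ ⌊y⌋ (r := d) (by exact_mod_cast hd)
  rw [hfl, hfl, max_eq_left (sub_nonneg.2 (Int.floor_mono (by gcongr)))] at h
  have h' : (((Finset.Ioc ⌊x⌋ ⌊y⌋).filter fun p => (d : ℤ) ∣ p).card : ℝ) =
      ⌊y / d⌋ - ⌊x / d⌋ := by exact_mod_cast h
  rw [h', sub_div, abs_le]
  have := Int.floor_le (y / d)
  have := Int.floor_le (x / d)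
  have := Int.lt_floor_add_one (y / d)
  have := Int.lt_floor_add_one (x / d)
  constructor <;> linarith

open ArithmeticFunction in
lemma sum_moebius_mul_div {q : ℕ} (hq : 0 < q) :
    ∑ d ∈ q.divisors, (moebius d : ℝ) * (q / d) = q.totient := by
  have h := (sum_eq_iff_sum_mul_moebius_eq (R := ℝ) (f := fun n => (n.totient : ℝ))
    (g := fun n => (n : ℝ))).1 (fun n _ => by exact_mod_cast Nat.sum_totient n) q hq
  rw [Nat.sum_divisorsAntidiagonal (fun a b => (moebius a : ℝ) * (b : ℝ))] at h
  rw [← h]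
  refine Finset.sum_congr rfl fun d hd => ?_
  rw [Nat.cast_div (Nat.dvd_of_mem_divisors hd)
    (by exact_mod_cast (Nat.pos_of_mem_divisors hd).ne')]

open ArithmeticFunction in
/-- The number of integers coprime to `q` in an interval. -/
lemma totient_mul_sub_card_divisors_le {x y : ℝ} (hxy : x ≤ y) {q : ℕ} (hq : 0 < q) :
    (q.totient : ℝ) / q * (y - x) - q.divisors.card ≤
      ((Finset.Ioc ⌊x⌋ ⌊y⌋).filter fun p => IsCoprime p (q : ℤ)).card := by
  have hq' : (0 : ℝ) < q := by exact_mod_cast hq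
  have hind : ∀ p : ℤ, (∑ d ∈ q.divisors, if (d : ℤ) ∣ p then (moebius d : ℝ) else 0) =
      if IsCoprime p (q : ℤ) then 1 else 0 := by
    intro p
    rw [← Finset.sum_filter]
    have h1 : q.divisors.filter (fun d : ℕ => (d : ℤ) ∣ p) = (Int.gcd p q).divisors := by
      ext d
      rw [Finset.mem_filter, Nat.mem_divisors, Nat.mem_divisors, Int.dvd_gcd_iff,
        Int.natCast_dvd_natCast]
      have : Int.gcd p q ≠ 0 := fun h => by
        rw [Int.gcd_eq_zero_iff] at h; lia
      have hq0 := hq.ne'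
      tauto
    have h2 := congrArg (fun f => f (Int.gcd p q)) (coe_moebius_mul_coe_zeta (R := ℝ))
    simp only [coe_mul_zeta_apply, intCoe_apply, one_apply] at h2
    rw [h1, h2]
    simp only [Int.isCoprime_iff_gcd_eq_one]
  have hcard : (((Finset.Ioc ⌊x⌋ ⌊y⌋).filter fun p => IsCoprime p (q : ℤ)).card : ℝ) =
      ∑ d ∈ q.divisors, (moebius d : ℝ) *
        ((Finset.Ioc ⌊x⌋ ⌊y⌋).filter fun p => (d : ℤ) ∣ p).card := by
    rw [Finset.card_filter]
    push_cast
    simp_rw [← hind]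
    rw [Finset.sum_comm]
    refine Finset.sum_congr rfl fun d _ => ?_
    rw [← Finset.sum_filter, Finset.sum_const, nsmul_eq_mul, mul_comm]
  rw [hcard, ← sum_moebius_mul_div hq, Finset.sum_div, Finset.sum_mul, Finset.cast_card,
    ← Finset.sum_sub_distrib]
  refine Finset.sum_le_sum fun d hd => ?_
  have hd0 := Nat.pos_of_mem_divisors hd
  have hd' : (0 : ℝ) < d := by exact_mod_cast hd0
  have h1 := abs_card_filter_dvd_sub_le hxy hd0
  set n := (((Finset.Ioc ⌊x⌋ ⌊y⌋).filter fun p => (d : ℤ) ∣ p).card : ℝ)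
  have hmu : |(moebius d : ℝ)| ≤ 1 := by exact_mod_cast abs_moebius_le_one (n := d)
  have h2 : |(moebius d : ℝ) * (n - (y - x) / d)| ≤ 1 := by
    rw [abs_mul]; exact mul_le_one₀ hmu (abs_nonneg _) h1
  have h3 := (abs_le.1 h2).1
  have h4 : (moebius d : ℝ) * (q / d) / q * (y - x) = (moebius d : ℝ) * ((y - x) / d) := by
    field_simp
  rw [h4]
  linarith

/-- The numerators of the reduced fractions with denominator `q` in the interval `(a, b]`,
roughly. -/
noncomputable def coprimeNumerators (a b : ℝ) (q : ℕ) : Finset ℤ :=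
  (Finset.Ioc ⌊a * q⌋ ⌊b * q⌋).filter fun p => IsCoprime p (q : ℤ)

lemma exists_eventually_le_sum_card_coprimeNumerators {δ : ℝ} (hδ : 0 < δ) :
    ∃ c : ℝ, 0 < c ∧ ∀ a b : ℝ, a < b → ∀ᶠ N : ℕ in atTop, ∀ X ⊆ Finset.Icc 1 N,
      δ * N ≤ X.card →
        c * (b - a) * N ^ 2 ≤ ∑ q ∈ X, ((coprimeNumerators a b q).card : ℝ) := by
  obtain ⟨θ, hθ, hbad⟩ := exists_card_totient_lt_le (κ := δ / 4) (by positivity)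
  refine ⟨θ * δ ^ 2 / 16, by positivity, fun a b hab => ?_⟩
  have hba : 0 < b - a := sub_pos.2 hab
  set η := θ * δ * (b - a) / 16 with hη
  have hη0 : 0 < η := by positivity
  obtain ⟨L, hL⟩ := exists_nat_gt (1 / η)
  have hL0 : (0 : ℝ) < L := lt_trans (by positivity) hL
  have hL0' : 0 < L := by exact_mod_cast hL0
  filter_upwards [eventually_ge_atTop ⌈L / η⌉₊] with N hN X hX hcard
  have hN1 : (L : ℝ) ≤ η * N := by
    have := Nat.ceil_le.1 hN
    rwa [div_le_iff₀ hη0, mul_comm] at this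
  have hN2 : (N : ℝ) / L ≤ η * N := by
    rw [div_le_iff₀ hL0]
    rw [div_lt_iff₀ hη0] at hL
    nlinarith [N.cast_nonneg (α := ℝ)]
  classical
  set G := X.filter fun q : ℕ => ¬ ((q : ℝ) ≤ δ / 4 * N) ∧ ¬ ((q.totient : ℝ) < θ * q) with hG
  have hGcard : δ / 2 * N ≤ G.card := by
    set B1 := (Finset.Icc 1 N).filter fun q : ℕ => (q : ℝ) ≤ δ / 4 * N
    set B2 := (Finset.Icc 1 N).filter fun q : ℕ => (q.totient : ℝ) < θ * q
    have hsub : X ⊆ G ∪ (B1 ∪ B2) := by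
      intro q hq
      simp only [hG, B1, B2, Finset.mem_union, Finset.mem_filter, hq, hX hq, true_and]
      tauto
    have h1 : X.card ≤ G.card + (B1.card + B2.card) :=
      (Finset.card_le_card hsub).trans ((Finset.card_union_le _ _).trans
        (by gcongr; exact Finset.card_union_le _ _))
    have h1' : (X.card : ℝ) ≤ G.card + (B1.card + B2.card) := by exact_mod_cast h1
    have h2 : (B1.card : ℝ) ≤ δ / 4 * N := by
      calc (B1.card : ℝ) ≤ ((Finset.Icc 1 ⌊δ / 4 * N⌋₊).card : ℝ) := by
            gcongr
            intro q hq
            obtain ⟨hq1, hq2⟩ := Finset.mem_filter.1 hq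
            exact Finset.mem_Icc.2 ⟨(Finset.mem_Icc.1 hq1).1, Nat.le_floor hq2⟩
        _ ≤ δ / 4 * N := by
            rw [Nat.card_Icc, Nat.add_sub_cancel]
            exact Nat.floor_le (by positivity)
    have h3 := hbad N
    linarith
  have hterm : ∀ q ∈ G, 2 * η * N ≤ ((coprimeNumerators a b q).card : ℝ) := by
    intro q hq
    obtain ⟨hqX, hq1, hq2⟩ := Finset.mem_filter.1 hq
    rw [not_le] at hq1
    rw [not_lt] at hq2
    obtain ⟨hq0, hqN⟩ := Finset.mem_Icc.1 (hX hqX)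
    have hq0' : (0 : ℝ) < q := by exact_mod_cast hq0
    have hqN' : (q : ℝ) ≤ N := by exact_mod_cast hqN
    have h1 := totient_mul_sub_card_divisors_le (x := a * q) (y := b * q) (by gcongr) hq0
    have h2 : (q.divisors.card : ℝ) ≤ L + N / L := by
      calc (q.divisors.card : ℝ) ≤ ((L + q / L : ℕ) : ℝ) := by
            exact_mod_cast card_divisors_le_add_div q hL0'
        _ ≤ L + q / L := by push_cast; gcongr; exact Nat.cast_div_le
        _ ≤ L + N / L := by gcongr
    have h3 : (q.totient : ℝ) / q * (b * q - a * q) = q.totient * (b - a) := by field_simp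
    have h4 : θ * (δ / 4 * N) * (b - a) ≤ q.totient * (b - a) := by
      gcongr
      exact le_trans (by gcongr) hq2
    have h5 : θ * (δ / 4 * N) * (b - a) = 4 * η * N := by rw [hη]; ring
    rw [coprimeNumerators]
    linarith
  calc θ * δ ^ 2 / 16 * (b - a) * N ^ 2 = (δ / 2 * N) * (2 * η * N) := by rw [hη]; ring
    _ ≤ G.card * (2 * η * N) := by gcongr
    _ = ∑ q ∈ G, 2 * η * N := by rw [Finset.sum_const, nsmul_eq_mul]
    _ ≤ ∑ q ∈ G, ((coprimeNumerators a b q).card : ℝ) := Finset.sum_le_sum hterm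
    _ ≤ _ := Finset.sum_le_sum_of_subset_of_nonneg (Finset.filter_subset _ _)
        fun _ _ _ => by positivity

/-- Points slightly to the left of a reduced fraction with denominator in `X`. -/
def leftApprox (X : Finset ℕ) (N : ℕ) (a b : ℝ) : Set ℝ :=
  ⋃ z ∈ X.sigma (coprimeNumerators a b),
    Ioo ((z.2 : ℝ) / z.1 - 1 / (2 * (N : ℝ) ^ 2)) ((z.2 : ℝ) / z.1)

lemma mem_coprimeNumerators {a b : ℝ} {q : ℕ} {p : ℤ} (h : p ∈ coprimeNumerators a b q) :
    a * q < p ∧ p ≤ b * q ∧ IsCoprime p (q : ℤ) := by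
  obtain ⟨h1, h2⟩ := Finset.mem_filter.1 h
  obtain ⟨h3, h4⟩ := Finset.mem_Ioc.1 h1
  exact ⟨Int.floor_lt.1 h3, Int.le_floor.1 h4, h2⟩

lemma one_div_sq_le_abs_sub {p p' : ℤ} {q q' N : ℕ} (hq : 0 < q) (hq' : 0 < q') (hqN : q ≤ N)
    (hqN' : q' ≤ N) (hne : p * q' ≠ p' * q) :
    1 / (N : ℝ) ^ 2 ≤ |(p : ℝ) / q - p' / q'| := by
  have h1 : (0 : ℝ) < q := by exact_mod_cast hq
  have h2 : (0 : ℝ) < q' := by exact_mod_cast hq'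
  have h3 : (q : ℝ) ≤ N := by exact_mod_cast hqN
  have h4 : (q' : ℝ) ≤ N := by exact_mod_cast hqN'
  have h5 : (1 : ℝ) ≤ |(p : ℝ) * q' - q * p'| := by
    have h := Int.one_le_abs (sub_ne_zero.2 hne)
    rw [mul_comm (q : ℝ)]
    exact_mod_cast h
  rw [div_sub_div _ _ h1.ne' h2.ne', abs_div, abs_of_pos (mul_pos h1 h2)]
  gcongr
  rw [sq]; gcongr

lemma volume_leftApprox {X : Finset ℕ} {N : ℕ} (hX : X ⊆ Finset.Icc 1 N) (a b : ℝ) :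
    volume (leftApprox X N a b) =
      ENNReal.ofReal ((∑ q ∈ X, ((coprimeNumerators a b q).card : ℝ)) / (2 * (N : ℝ) ^ 2)) := by
  rw [leftApprox, measure_biUnion_finset ?_ fun _ _ => measurableSet_Ioo]
  · simp only [Real.volume_Ioo, sub_sub_cancel]
    rw [Finset.sum_const, Finset.card_sigma, nsmul_eq_mul, ← ENNReal.ofReal_natCast,
      ← ENNReal.ofReal_mul (Nat.cast_nonneg _), mul_one_div]
    push_cast
    rfl
  · rintro ⟨q, p⟩ h ⟨q', p'⟩ h' hne
    rw [Finset.mem_coe, Finset.mem_sigma] at h h'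
    obtain ⟨-, -, hc⟩ := mem_coprimeNumerators h.2
    obtain ⟨-, -, hc'⟩ := mem_coprimeNumerators h'.2
    obtain ⟨hq, hqN⟩ := Finset.mem_Icc.1 (hX h.1)
    obtain ⟨hq', hqN'⟩ := Finset.mem_Icc.1 (hX h'.1)
    dsimp only at hq hqN hq' hqN' hc hc'
    have hne' : p * q' ≠ p' * q := by
      intro he
      apply hne
      have := Rat.div_int_inj (a := p) (b := q) (c := p') (d := q') (by exact_mod_cast hq)
        (by exact_mod_cast hq') (Int.isCoprime_iff_gcd_eq_one.1 hc)
        (Int.isCoprime_iff_gcd_eq_one.1 hc') (by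
          rw [div_eq_div_iff (by exact_mod_cast Nat.one_le_iff_ne_zero.1 hq)
            (by exact_mod_cast Nat.one_le_iff_ne_zero.1 hq')]
          exact_mod_cast he)
      obtain ⟨h1, h2⟩ := this
      obtain rfl : q = q' := by exact_mod_cast h2
      rw [h1]
    have hsep := one_div_sq_le_abs_sub hq hq' hqN hqN' hne'
    rw [Function.onFun, Set.disjoint_left]
    rintro x ⟨h1, h2⟩ ⟨h3, h4⟩
    dsimp only at h1 h2 h3 h4
    have hhalf : 1 / (N : ℝ) ^ 2 = 2 * (1 / (2 * (N : ℝ) ^ 2)) := by ring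
    have hN : 0 < 1 / (2 * (N : ℝ) ^ 2) := by
      have : (0 : ℝ) < N := by exact_mod_cast Nat.lt_of_lt_of_le hq hqN
      positivity
    rcases le_abs.1 hsep with h | h <;> linarith

lemma leftApprox_subset {X : Finset ℕ} {N : ℕ} (hX : X ⊆ Finset.Icc 1 N) (a b : ℝ) :
    leftApprox X N a b ⊆ Ioo (a - 1 / (2 * (N : ℝ) ^ 2)) b := by
  intro x hx
  simp only [leftApprox, mem_iUnion] at hx
  obtain ⟨⟨q, p⟩, hz, h1, h2⟩ := hx
  rw [Finset.mem_sigma] at hz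
  obtain ⟨h3, h4, -⟩ := mem_coprimeNumerators hz.2
  have hq : (0 : ℝ) < q := by exact_mod_cast (Finset.mem_Icc.1 (hX hz.1)).1
  dsimp only at h1 h2 h3 h4
  rw [← lt_div_iff₀ hq] at h3
  rw [← div_le_iff₀ hq] at h4
  exact ⟨by linarith, by linarith⟩

lemma exists_odd_cfQ_mem_of_mem_leftApprox {X : Finset ℕ} {N : ℕ} (hX : X ⊆ Finset.Icc 1 N)
    {a b x : ℝ} (hx : x ∈ leftApprox X N a b) (hx' : x ∈ unitIrr) :
    ∃ k, Odd k ∧ cfQ x k ∈ X := by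
  simp only [leftApprox, mem_iUnion] at hx
  obtain ⟨⟨q, p⟩, hz, h1, h2⟩ := hx
  rw [Finset.mem_sigma] at hz
  obtain ⟨-, -, hc⟩ := mem_coprimeNumerators hz.2
  obtain ⟨hq, hqN⟩ := Finset.mem_Icc.1 (hX hz.1)
  dsimp only at h1 h2 hc hq hqN
  have hq0 : (0 : ℝ) < q := by exact_mod_cast hq
  have hqN' : (q : ℝ) ≤ N := by exact_mod_cast hqN
  rw [lt_div_iff₀ hq0] at h2
  have h3 : (p : ℝ) - q * x < 1 / (2 * q) := by
    have h4 : 1 / (2 * (N : ℝ) ^ 2) ≤ 1 / (2 * (q : ℝ) ^ 2) := by gcongr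
    have h5 : (p : ℝ) / q - x < 1 / (2 * (q : ℝ) ^ 2) := by linarith
    calc (p : ℝ) - q * x = q * (p / q - x) := by field_simp
      _ < q * (1 / (2 * (q : ℝ) ^ 2)) := by gcongr
      _ = 1 / (2 * q) := by field_simp
  obtain ⟨k, hk, hkq⟩ := exists_odd_cfQ_eq hx' hq hc (by linarith) h3
  exact ⟨k, hk, by rw [hkq]; exact hz.1⟩

lemma le_of_odd_of_cfQ_le {x : ℝ} (hx : x ∈ unitIrr) {k n : ℕ} (hk : Odd k)
    (h : cfQ x k ≤ 2 ^ n) : k ≤ 2 * n + 1 := by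
  obtain ⟨j, rfl⟩ := hk
  have h1 := (two_pow_le_cfQ hx j).trans ((monotone_cfQ hx (Nat.le_succ _)).trans h)
  have := (Nat.pow_le_pow_iff_right (by norm_num)).1 h1
  lia

lemma not_summable_one_div_add_one {a : ℝ} (ha : 0 ≤ a) (m₀ : ℕ) :
    ¬ Summable fun m : ℕ => 1 / (a * ((m + m₀ : ℕ) * Real.log (m + m₀ : ℕ)) + 1) := by
  intro h
  rw [summable_nat_add_iff (f := fun m : ℕ => 1 / (a * (m * Real.log m) + 1)) m₀] at h
  have hlog : ∀ m : ℕ, 0 ≤ Real.log m := fun m => Real.log_natCast_nonneg m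
  have h2 : Summable fun m : ℕ => 1 / ((m : ℝ) * (1 + Real.log m)) := by
    refine Summable.of_nonneg_of_le (fun m => ?_) (fun m => ?_) (h.mul_left (a + 1))
    · have := hlog m
      positivity
    · have := hlog m
      rcases Nat.eq_zero_or_pos m with rfl | hm
      · simp; linarith
      · have hm' : (1 : ℝ) ≤ m := by exact_mod_cast hm
        rw [mul_one_div, div_le_div_iff₀ (by positivity) (by positivity)]
        nlinarith [mul_nonneg (sub_nonneg.2 hm') this, mul_nonneg ha this,
          mul_nonneg ha (zero_le_one.trans hm')]
  rw [← summable_condensed_iff_of_nonneg] at h2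
  · have h3 : Summable fun k : ℕ => 1 / ((k + 1 : ℕ) : ℝ) := by
      refine Summable.of_nonneg_of_le (fun k => by positivity) (fun k => ?_) h2
      push_cast
      rw [Real.log_pow]
      have hl2 : Real.log 2 ≤ 1 := by have := Real.log_two_lt_d9; linarith
      have hl0 : 0 ≤ Real.log 2 := Real.log_nonneg (by norm_num)
      rw [mul_one_div, div_mul_eq_div_div, div_self (by positivity)]
      have : (k : ℝ) * Real.log 2 ≤ k * 1 := by gcongr
      exact one_div_le_one_div_of_le (by positivity) (by linarith)
    rw [summable_nat_add_iff (f := fun k : ℕ => 1 / (k : ℝ)) 1] at h3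
    exact Real.not_summable_one_div_natCast h3
  · intro m
    have := hlog m
    positivity
  · intro m n hm hmn
    have hm' : (0 : ℝ) < m := by exact_mod_cast hm
    have hmn' : (m : ℝ) ≤ n := by exact_mod_cast hmn
    have := hlog m
    have h4 := Real.log_le_log hm' hmn'
    gcongr

/-- The `k`-th denominator lies in `A`, `k` is odd, and the next partial quotient exceeds `M` times
the sum of the previous ones. -/
def IsGoodIndex (A : Set ℕ) (M : ℕ) (x : ℝ) (k : ℕ) : Prop :=
  Odd k ∧ cfQ x k ∈ A ∧ M * ∑ i ∈ Finset.Icc 1 k, cfA x i < cfA x (k + 1)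

/-- The points all of whose good indices have denominator less than `Q`. -/
def exceptionalSet (A : Set ℕ) (M Q : ℕ) : Set ℝ :=
  {x | x ∈ unitIrr ∧ ∀ k, Q ≤ cfQ x k → ¬ IsGoodIndex A M x k}

/-- The points with `k` odd, `q_k ∈ X`, `a_1 + ⋯ + a_k ≤ t` and no good index before `k`. -/
def noGoodBefore (A : Set ℕ) (M Q : ℕ) (X : Finset ℕ) (t : ℝ) (k : ℕ) : Set ℝ :=
  {x | x ∈ unitIrr ∧ Odd k ∧ cfQ x k ∈ X ∧ ∑ i ∈ Finset.Icc 1 k, (cfA x i : ℝ) ≤ t ∧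
    ∀ j < k, Q ≤ cfQ x j → ¬ IsGoodIndex A M x j}

lemma cfCylinder_subset_noGoodBefore {A : Set ℕ} {M Q : ℕ} {X : Finset ℕ} {t : ℝ} {k : ℕ} {x : ℝ}
    (hx : x ∈ noGoodBefore A M Q X t k) : cfCylinder x k ⊆ noGoodBefore A M Q X t k := by
  rintro y ⟨hy, hyx⟩
  obtain ⟨-, hk, hq, ht, hg⟩ := hx
  have hQ : ∀ j ≤ k, cfQ y j = cfQ x j := fun j hj =>
    (cfP_cfQ_congr fun i h1 h2 => hyx i h1 (h2.trans hj)).2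
  refine ⟨hy, hk, by rwa [hQ k le_rfl], ?_, fun j hj hqj => ?_⟩
  · rwa [Finset.sum_congr rfl fun i hi => by
      rw [hyx i (Finset.mem_Icc.1 hi).1 (Finset.mem_Icc.1 hi).2]]
  · have hsum : ∑ i ∈ Finset.Icc 1 j, cfA y i = ∑ i ∈ Finset.Icc 1 j, cfA x i :=
      Finset.sum_congr rfl fun i hi =>
        hyx i (Finset.mem_Icc.1 hi).1 ((Finset.mem_Icc.1 hi).2.trans hj.le)
    rw [hQ j hj.le] at hqj
    have := hg j hj hqj
    rwa [IsGoodIndex, hQ j hj.le, hsum, hyx (j + 1) (by lia) hj]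

lemma isGoodIndex_of_gaussIter_lt {A : Set ℕ} {M Q : ℕ} {X : Finset ℕ} {t : ℝ} {k : ℕ} {x : ℝ}
    (hXA : ∀ q ∈ X, q ∈ A) (ht : 0 ≤ t) (hx : x ∈ noGoodBefore A M Q X t k)
    (h : gaussIter x k < 1 / (M * t + 1)) : IsGoodIndex A M x k := by
  obtain ⟨hx, hk, hq, hS, -⟩ := hx
  refine ⟨hk, hXA _ hq, ?_⟩
  have h0 : 0 < gaussIter x k := (gaussIter_mem_unitIrr hx k).2.1
  have h1 : M * t + 1 < 1 / gaussIter x k := (lt_one_div h0 (by positivity)).1 h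
  have h2 : 1 / gaussIter x k - 1 < cfA x (k + 1) := Nat.sub_one_lt_floor _
  have h3 : (M : ℝ) * ∑ i ∈ Finset.Icc 1 k, (cfA x i : ℝ) ≤ M * t := by gcongr
  have h4 : (M : ℝ) * ∑ i ∈ Finset.Icc 1 k, (cfA x i : ℝ) < cfA x (k + 1) := by linarith
  exact_mod_cast h4

lemma summable_of_le_volume_exceptionalSet {A : Set ℕ} {M Q : ℕ} {X : ℕ → Finset ℕ}
    (hXA : ∀ m, ∀ q ∈ X m, q ∈ A ∧ Q ≤ q) (hX : Pairwise (Function.onFun Disjoint X))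
    {t : ℕ → ℝ} (ht : ∀ m, 0 ≤ t m) {c : ℝ} (hc : 0 < c)
    (h : ∀ m, ENNReal.ofReal c ≤ volume (exceptionalSet A M Q ∩
      {x | ∃ k, Odd k ∧ cfQ x k ∈ X m ∧ ∑ i ∈ Finset.Icc 1 k, (cfA x i : ℝ) ≤ t m})) :
    Summable fun m => 1 / (M * t m + 1) := by
  set s : ℕ → ℝ := fun m => 1 / (M * t m + 1) with hs
  have hs0 : ∀ m, 0 < s m := fun m => by have := ht m; simp only [hs]; positivity
  have hs1 : ∀ m, s m ≤ 1 := fun m => by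
    have := ht m
    simp only [hs]
    rw [div_le_one (by positivity)]
    nlinarith [mul_nonneg (Nat.cast_nonneg (α := ℝ) M) this]
  set G : ℕ → ℕ → Set ℝ := fun m k => noGoodBefore A M Q (X m) (t m) (k + 1) with hG
  set H : ℕ × ℕ → Set ℝ := fun z => G z.1 z.2 ∩ {x | gaussIter x (z.2 + 1) < s z.1} with hH
  have hGH : ∀ m k, MeasurableSet (G m k) ∧
      ENNReal.ofReal (s m) * volume (G m k) ≤ volume (H (m, k)) := fun m k =>
    le_volume_inter_gaussIter_lt (fun x hx => hx.1)
      (fun x hx => cfCylinder_subset_noGoodBefore hx) (hs0 m) (hs1 m)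
  have hHm : ∀ z, MeasurableSet (H z) := fun z =>
    (hGH z.1 z.2).1.inter (measurableSet_gaussIter_lt _ _)
  have hgood : ∀ {m k x}, x ∈ H (m, k) →
      Q ≤ cfQ x (k + 1) ∧ IsGoodIndex A M x (k + 1) := fun {m k x} hx =>
    ⟨(hXA m _ hx.1.2.2.1).2,
      isGoodIndex_of_gaussIter_lt (fun q hq => (hXA m q hq).1) (ht m) hx.1 hx.2⟩
  have hlt : ∀ {m k m' k' x}, x ∈ H (m, k) → x ∈ H (m', k') → ¬ k < k' :=
    fun {m k m' k' x} hx hx' hkk =>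
      hx'.1.2.2.2.2 (k + 1) (by lia) (hgood hx).1 (hgood hx).2
  have hHd : Pairwise (Function.onFun Disjoint H) := by
    rintro ⟨m, k⟩ ⟨m', k'⟩ hne
    rw [Function.onFun, Set.disjoint_left]
    intro x hx hx'
    obtain rfl : k = k' := le_antisymm (not_lt.1 (hlt hx' hx)) (not_lt.1 (hlt hx hx'))
    have hmm : m ≠ m' := fun h => hne (by rw [h])
    exact Finset.disjoint_left.1 (hX hmm) hx.1.2.2.1 hx'.1.2.2.1
  have hHs : ∑' z, volume (H z) ≤ 1 := by
    rw [← measure_iUnion hHd hHm, ← volume_unitIrr]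
    exact measure_mono (iUnion_subset fun z x hx => hx.1.1)
  have hcG : ∀ m, ENNReal.ofReal c ≤ ∑' k, volume (G m k) := fun m => by
    refine (h m).trans ((measure_mono ?_).trans (measure_iUnion_le _))
    rintro x ⟨⟨hx, hx'⟩, k, hk, hq, hS⟩
    obtain ⟨j, rfl⟩ := hk
    exact mem_iUnion.2 ⟨2 * j, hx, ⟨j, rfl⟩, hq, hS, fun i _ => hx' i⟩
  have hsum : ENNReal.ofReal c * ∑' m, ENNReal.ofReal (s m) ≤ 1 := by
    rw [mul_comm, ← ENNReal.tsum_mul_right]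
    refine le_trans ?_ hHs
    rw [ENNReal.tsum_prod']
    refine ENNReal.tsum_le_tsum fun m => ?_
    calc ENNReal.ofReal (s m) * ENNReal.ofReal c
        ≤ ENNReal.ofReal (s m) * ∑' k, volume (G m k) := by gcongr; exact hcG m
      _ = ∑' k, ENNReal.ofReal (s m) * volume (G m k) := ENNReal.tsum_mul_left.symm
      _ ≤ ∑' k, volume (H (m, k)) := ENNReal.tsum_le_tsum fun k => (hGH m k).2
  have hne : ∑' m, ENNReal.ofReal (s m) ≠ ⊤ := by
    intro htop
    rw [htop, ENNReal.mul_top (by simpa using hc)] at hsum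
    simp at hsum
  have := ENNReal.summable_toReal hne
  simpa only [ENNReal.toReal_ofReal (hs0 _).le] using this

lemma measurableSet_exceptionalSet (A : Set ℕ) (M Q : ℕ) :
    MeasurableSet (exceptionalSet A M Q) := by
  have hq : ∀ k, ∀ s : Set ℕ, MeasurableSet {x | cfQ x k ∈ s} := fun k s =>
    measurable_cfQ k (MeasurableSet.of_discrete (s := s))
  have hg : ∀ k, MeasurableSet {x | IsGoodIndex A M x k} := fun k =>
    (MeasurableSet.const _).inter ((hq k A).inter (measurableSet_lt
      ((Finset.measurable_sum _ fun i _ => measurable_cfA i).const_mul M) (measurable_cfA (k + 1))))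
  have : exceptionalSet A M Q =
      unitIrr ∩ ⋂ k, ({x | cfQ x k ∈ Ici Q}ᶜ ∪ {x | IsGoodIndex A M x k}ᶜ) := by
    ext x
    simp only [exceptionalSet, mem_ofPred_eq, mem_inter_iff, mem_iInter, mem_union, mem_compl_iff,
      mem_Ici, imp_iff_not_or]
  rw [this]
  exact measurableSet_unitIrr.inter
    (MeasurableSet.iInter fun k => (hq k _).compl.union (hg k).compl)

lemma exists_volume_closedBall_diff_le {E : Set ℝ} (hE : MeasurableSet E) (h0 : volume E ≠ 0)
    {η : ℝ} (hη : 0 < η) :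
    ∃ x r : ℝ, 0 < r ∧ volume (Metric.closedBall x r \ E) ≤ ENNReal.ofReal (η * (2 * r)) := by
  have : (ae (volume.restrict E)).NeBot := by
    rwa [ae_neBot, Ne, Measure.restrict_eq_zero]
  obtain ⟨x, hx⟩ := (Besicovitch.ae_tendsto_measure_inter_div volume E).exists
  have hlt : 1 - ENNReal.ofReal η < 1 :=
    ENNReal.sub_lt_self ENNReal.one_ne_top one_ne_zero (by simpa using hη)
  obtain ⟨r, hr, hr0⟩ := ((hx.eventually (lt_mem_nhds hlt)).and self_mem_nhdsWithin).exists
  have hr0 : 0 < r := hr0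
  refine ⟨x, r, hr0, ?_⟩
  rw [ENNReal.ofReal_mul hη.le, ← Real.volume_closedBall x r]
  set v := volume (Metric.closedBall x r) with hv
  have hvt : v ≠ ⊤ := by rw [hv, Real.volume_closedBall]; exact ENNReal.ofReal_ne_top
  have h1 : (1 - ENNReal.ofReal η) * v ≤ volume (Metric.closedBall x r ∩ E) := by
    rw [inter_comm]
    exact ENNReal.mul_le_of_le_div hr.le
  have hfin : volume (Metric.closedBall x r ∩ E) ≠ ⊤ :=
    ne_top_of_le_ne_top hvt (measure_mono inter_subset_left)
  refine (ENNReal.add_le_add_iff_left hfin).1 ?_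
  rw [measure_inter_add_sdiff _ hE]
  calc v = 1 * v := (one_mul v).symm
    _ ≤ (1 - ENNReal.ofReal η + ENNReal.ofReal η) * v := by gcongr; exact le_tsub_add
    _ = (1 - ENNReal.ofReal η) * v + ENNReal.ofReal η * v := add_mul _ _ _
    _ ≤ _ := by gcongr

open scoped Classical in
lemma eventually_le_card_of_lowerDensity_pos {A : Set ℕ} (hA : 0 < lowerDensity A) :
    ∀ᶠ N : ℕ in atTop, lowerDensity A / 2 * N ≤ ((Finset.Icc 1 N).filter (· ∈ A)).card := by
  have h : lowerDensity A / 2 <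
      liminf (fun N : ℕ => (((Finset.Icc 1 N).filter (· ∈ A)).card : ℝ) / N) atTop :=
    half_lt_self hA
  filter_upwards [eventually_lt_of_lt_liminf h
    (isBoundedUnder_of ⟨0, fun N => by positivity⟩), eventually_gt_atTop 0] with N hN hN0
  have : (0 : ℝ) < N := by exact_mod_cast hN0
  exact ((lt_div_iff₀ this).1 hN).le

lemma tendsto_two_pow_mul_atTop {ρ : ℕ} (hρ : 0 < ρ) :
    Tendsto (fun n : ℕ => 2 ^ (ρ * n)) atTop (atTop : Filter ℕ) :=
  (tendsto_pow_atTop_atTop_of_one_lt one_lt_two).comp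
    (tendsto_atTop_mono (fun n => Nat.le_mul_of_pos_left n hρ) tendsto_id)

open scoped Classical in
lemma exists_eventually_le_card_block {A : Set ℕ} (hA : 0 < lowerDensity A) :
    ∃ δ : ℝ, 0 < δ ∧ ∃ ρ : ℕ, 0 < ρ ∧ ∀ᶠ n : ℕ in atTop,
      δ * (2 ^ (ρ * (n + 1)) : ℕ) ≤
        ((Finset.Ioc (2 ^ (ρ * n)) (2 ^ (ρ * (n + 1)))).filter (· ∈ A)).card := by
  set δ := lowerDensity A / 4 with hδ
  have hδ0 : 0 < δ := by positivity
  obtain ⟨ρ, hρ⟩ := exists_pow_lt_of_lt_one hδ0 (by norm_num : (1 / 2 : ℝ) < 1)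
  refine ⟨δ, hδ0, ρ + 1, ρ.succ_pos, ?_⟩
  have htend := (tendsto_two_pow_mul_atTop ρ.succ_pos).comp (tendsto_add_atTop_nat 1)
  filter_upwards [htend.eventually (eventually_le_card_of_lowerDensity_pos hA)] with n hn
  have hsub : (Finset.Icc 1 (2 ^ ((ρ + 1) * (n + 1)))).filter (· ∈ A) ⊆
      Finset.Icc 1 (2 ^ ((ρ + 1) * n)) ∪
        (Finset.Ioc (2 ^ ((ρ + 1) * n)) (2 ^ ((ρ + 1) * (n + 1)))).filter (· ∈ A) := by
    intro q hq
    simp only [Finset.mem_union, Finset.mem_filter, Finset.mem_Icc, Finset.mem_Ioc] at hq ⊢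
    lia
  have hcard := (Finset.card_le_card hsub).trans (Finset.card_union_le _ _)
  rw [Nat.card_Icc, Nat.add_sub_cancel] at hcard
  have hcard' : (((Finset.Icc 1 (2 ^ ((ρ + 1) * (n + 1)))).filter (· ∈ A)).card : ℝ) ≤
      2 ^ ((ρ + 1) * n) +
        ((Finset.Ioc (2 ^ ((ρ + 1) * n)) (2 ^ ((ρ + 1) * (n + 1)))).filter (· ∈ A)).card := by
    exact_mod_cast hcard
  have hpow : (2 : ℝ) ^ ((ρ + 1) * n) ≤ δ * (2 ^ ((ρ + 1) * (n + 1)) : ℕ) := by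
    have h1 : (1 / 2 : ℝ) ^ (ρ + 1) ≤ δ :=
      (pow_le_pow_of_le_one (by norm_num) (by norm_num) ρ.le_succ).trans hρ.le
    calc (2 : ℝ) ^ ((ρ + 1) * n) = (1 / 2 : ℝ) ^ (ρ + 1) * 2 ^ ((ρ + 1) * (n + 1)) := by
          rw [mul_add_one (ρ + 1) n, pow_add 2 ((ρ + 1) * n) (ρ + 1), mul_left_comm, ← mul_pow]
          norm_num
      _ ≤ δ * 2 ^ ((ρ + 1) * (n + 1)) := by gcongr
      _ = _ := by push_cast; rfl
  have hd : lowerDensity A / 2 = 2 * δ := by rw [hδ]; ring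
  simp only [Function.comp_apply, hd] at hn
  linarith

lemma volume_exceptionalSet {A : Set ℕ} (hA : 0 < lowerDensity A) (M Q : ℕ) :
    volume (exceptionalSet A M Q) = 0 := by
  classical
  by_contra hE
  obtain ⟨δ, hδ, ρ, hρ, hblock⟩ := exists_eventually_le_card_block hA
  obtain ⟨c, hc, hcount⟩ := exists_eventually_le_sum_card_coprimeNumerators hδ
  obtain ⟨x, r, hr, hball⟩ := exists_volume_closedBall_diff_le
    (measurableSet_exceptionalSet A M Q) hE (show 0 < c / 8 by positivity)
  obtain ⟨C, hC, hsumA⟩ :=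
    exists_eventually_volume_lt_sum_cfA_le (2 * ρ + 1) (show 0 < c * r / 8 by positivity)
  have htend := tendsto_two_pow_mul_atTop hρ
  have hsmall : ∀ᶠ N : ℕ in atTop, 1 / (2 * (N : ℝ) ^ 2) < r := by
    have h1 : Tendsto (fun N : ℕ => 1 / (N : ℝ)) atTop (𝓝 0) := tendsto_one_div_atTop_nhds_zero_nat
    filter_upwards [h1.eventually (gt_mem_nhds hr), eventually_gt_atTop 0] with N hN hN0
    refine lt_of_le_of_lt ?_ hN
    have : (1 : ℝ) ≤ N := by exact_mod_cast hN0
    apply one_div_le_one_div_of_le <;> nlinarith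
  have hall := hblock.and ((htend.eventually_ge_atTop Q).and
    (((htend.comp (tendsto_add_atTop_nat 1)).eventually
      ((hcount x (x + r) (by linarith)).and hsmall)).and
      ((tendsto_add_atTop_nat 1).eventually hsumA)))
  obtain ⟨m₀, hm₀⟩ := eventually_atTop.1 hall
  set X : ℕ → Finset ℕ := fun m =>
    (Finset.Ioc (2 ^ (ρ * (m + m₀))) (2 ^ (ρ * (m + m₀ + 1)))).filter (· ∈ A) with hX
  have hmemX : ∀ {m q}, q ∈ X m →
      (2 ^ (ρ * (m + m₀)) < q ∧ q ≤ 2 ^ (ρ * (m + m₀ + 1))) ∧ q ∈ A := fun {m q} hq => by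
    simpa only [hX, Finset.mem_filter, Finset.mem_Ioc] using hq
  refine not_summable_one_div_add_one (a := M * C) (by positivity) (m₀ + 1) ?_
  have hXd : Pairwise (Function.onFun Disjoint X) := by
    refine (pairwise_disjoint_on X).2 fun m n hmn => Finset.disjoint_left.2 fun q hq hq' => ?_
    have h1 : 2 ^ (ρ * (m + m₀ + 1)) ≤ 2 ^ (ρ * (n + m₀)) :=
      Nat.pow_le_pow_right two_pos (Nat.mul_le_mul_left _ (by lia))
    exact absurd ((hmemX hq).1.2.trans h1) (not_le.2 (hmemX hq').1.1)
  have key := summable_of_le_volume_exceptionalSet (A := A) (M := M) (Q := Q) (X := X)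
    (t := fun m => C * ((m + (m₀ + 1) : ℕ) * Real.log (m + (m₀ + 1) : ℕ)))
    (fun m q hq => ⟨(hmemX hq).2, (hm₀ (m + m₀) (by lia)).2.1.trans (hmemX hq).1.1.le⟩)
    hXd (fun m => ?_) (show 0 < c * r / 8 by positivity) (fun m => ?_)
  · simpa only [mul_assoc] using key
  · have := Real.log_natCast_nonneg (m + (m₀ + 1))
    positivity
  · obtain ⟨h1, -, ⟨h2, h3⟩, h4⟩ := hm₀ (m + m₀) (by lia)
    simp only [Function.comp_apply] at h2 h3
    rw [← add_assoc]
    set N : ℕ := 2 ^ (ρ * (m + m₀ + 1)) with hN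
    have hN0 : (0 : ℝ) < N := by rw [hN]; positivity
    have hXN : X m ⊆ Finset.Icc 1 N := fun q hq =>
      Finset.mem_Icc.2 ⟨(Nat.zero_le _).trans_lt (hmemX hq).1.1, (hmemX hq).1.2⟩
    have hV : ENNReal.ofReal (c * r / 2) ≤ volume (leftApprox (X m) N x (x + r)) := by
      rw [volume_leftApprox hXN]
      apply ENNReal.ofReal_le_ofReal
      have := h2 (X m) hXN h1
      rw [add_sub_cancel_left] at this
      rw [le_div_iff₀ (by positivity)]
      linarith
    set D : Set ℝ := {x | ∃ k, Odd k ∧ cfQ x k ∈ X m ∧ ∑ i ∈ Finset.Icc 1 k, (cfA x i : ℝ) ≤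
      C * ((m + m₀ + 1 : ℕ) * Real.log (m + m₀ + 1 : ℕ))} with hD
    set B : Set ℝ := unitIrr ∩ {x | C * ((m + m₀ + 1 : ℕ) * Real.log (m + m₀ + 1 : ℕ)) <
      ∑ i ∈ Finset.Icc 1 ((2 * ρ + 1) * (m + m₀ + 1)), (cfA x i : ℝ)} with hB
    have hcover : leftApprox (X m) N x (x + r) ⊆
        exceptionalSet A M Q ∩ D ∪ (Metric.closedBall x r \ exceptionalSet A M Q ∪ B) := by
      intro y hy
      by_cases hyE : y ∈ exceptionalSet A M Q
      · obtain ⟨k, hk, hq⟩ := exists_odd_cfQ_mem_of_mem_leftApprox hXN hy hyE.1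
        by_cases hS : ∑ i ∈ Finset.Icc 1 k, (cfA y i : ℝ) ≤
            C * ((m + m₀ + 1 : ℕ) * Real.log (m + m₀ + 1 : ℕ))
        · exact Or.inl ⟨hyE, k, hk, hq, hS⟩
        · refine Or.inr (Or.inr ⟨hyE.1, (not_le.1 hS).trans_le ?_⟩)
          have hkle := le_of_odd_of_cfQ_le hyE.1 hk (hmemX hq).1.2
          refine Finset.sum_le_sum_of_subset_of_nonneg
            (Finset.Icc_subset_Icc_right ?_) fun _ _ _ => Nat.cast_nonneg _
          nlinarith
      · refine Or.inr (Or.inl ⟨?_, hyE⟩)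
        obtain ⟨h5, h6⟩ := leftApprox_subset hXN _ _ hy
        rw [Real.closedBall_eq_Icc]
        exact ⟨by linarith, h6.le⟩
    have hle := hV.trans ((measure_mono hcover).trans ((measure_union_le _ _).trans
      (add_le_add_right ((measure_union_le _ _).trans (add_le_add hball h4)) _)))
    rw [← ENNReal.ofReal_add (by positivity) (by positivity),
      show c * r / 2 = c * r / 8 + (c / 8 * (2 * r) + c * r / 8) by ring,
      ENNReal.ofReal_add (by positivity) (by positivity)] at hle
    exact (ENNReal.add_le_add_iff_right ENNReal.ofReal_ne_top).1 hle

lemma volume_preimage_iota {S : Set ℝ} (hS : MeasurableSet S) (h0 : volume S = 0) :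
    volume (iota ⁻¹' S) = 0 := by
  have hm : MeasurableSet (iota ⁻¹' S) :=
    (measurable_subtype_coe.comp (AddCircle.measurableEquivIco 1 0).measurable) hS
  rw [AddCircle.add_projection_respects_measure 1 0 hm]
  refine measure_mono_null (t := S ∪ {1}) ?_ (measure_union_null h0 (measure_singleton _))
  rintro y ⟨hy, hy0, hy1⟩
  rcases eq_or_ne y 1 with rfl | hne
  · exact Or.inr rfl
  · have hy' : y ∈ Ico (0 : ℝ) (0 + 1) := ⟨hy0.le, hy1.lt_of_ne (by simpa using hne)⟩
    have : iota (y : UnitAddCircle) = y := by rw [iota, AddCircle.equivIco_coe_eq hy']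
    rw [mem_preimage, mem_preimage, this] at hy
    exact Or.inl hy

lemma ae_iota_mem_unitIrr : ∀ᵐ α : UnitAddCircle, iota α ∈ unitIrr := by
  have h : volume (Ico (0 : ℝ) 1 \ unitIrr) = 0 := by
    have hsub : unitIrr ⊆ Ico 0 1 := fun x hx => Ioo_subset_Ico_self hx.2
    rw [measure_sdiff hsub measurableSet_unitIrr.nullMeasurableSet
      (by rw [volume_unitIrr]; exact ENNReal.one_ne_top), volume_unitIrr]
    simp
  refine measure_mono_null ?_
    (volume_preimage_iota (measurableSet_Ico.diff measurableSet_unitIrr) h)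
  intro α hα
  refine ⟨?_, hα⟩
  simpa [iota] using (AddCircle.equivIco (1 : ℝ) 0 α).2

/-- For `A ⊆ ℕ` of positive lower density, for a.e. `α ∈ 𝕋` there is a strictly
increasing sequence `(k_j)` of odd positive integers with `q_(k_j) ∈ A` and
`(∑_(i=1)^(k_j) a_i) / a_(k_j + 1) → 0`. -/
theorem exists_large_partial_quotients_odd (A : Set ℕ) (hA : 0 < lowerDensity A) :
    ∀ᵐ α ∂(volume : Measure UnitAddCircle), ∃ k : ℕ → ℕ,
      StrictMono k ∧ (∀ j, Odd (k j)) ∧ (∀ j, 0 < k j) ∧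
      (∀ j, cfQ (iota α) (k j) ∈ A) ∧
      Filter.Tendsto
        (fun j => (∑ i ∈ Finset.Icc 1 (k j), (cfA (iota α) i : ℝ)) / (cfA (iota α) (k j + 1)))
        Filter.atTop (nhds 0) := by
  have hall : ∀ᵐ α : UnitAddCircle, ∀ M Q, iota α ∉ exceptionalSet A M Q :=
    ae_all_iff.2 fun M => ae_all_iff.2 fun Q => by
      simp only [ae_iff, not_not]
      exact volume_preimage_iota (measurableSet_exceptionalSet A M Q) (volume_exceptionalSet hA M Q)
  filter_upwards [ae_iota_mem_unitIrr, hall] with α hα hgood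
  have hfreq : ∀ M, ∃ᶠ k in atTop, IsGoodIndex A M (iota α) k := by
    refine fun M => frequently_atTop'.2 fun n => ?_
    by_contra hcon
    push Not at hcon
    refine hgood M (cfQ (iota α) n + 1) ⟨hα, fun k hk => hcon k ?_⟩
    exact lt_of_not_ge fun hkn => absurd (monotone_cfQ hα hkn) (by lia)
  obtain ⟨k, hk, hkg⟩ := extraction_forall_of_frequently hfreq
  refine ⟨k, hk, fun j => (hkg j).1, fun j => (hkg j).1.pos, fun j => (hkg j).2.1, ?_⟩
  refine squeeze_zero' (g := fun j : ℕ => 1 / (j : ℝ)) (.of_forall fun j => ?_) ?_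
    tendsto_one_div_atTop_nhds_zero_nat
  · exact div_nonneg (Finset.sum_nonneg fun _ _ => Nat.cast_nonneg _) (Nat.cast_nonneg _)
  filter_upwards [eventually_gt_atTop 0] with j hj
  have hlt : (j : ℝ) * ∑ i ∈ Finset.Icc 1 (k j), (cfA (iota α) i : ℝ) <
      cfA (iota α) (k j + 1) := by exact_mod_cast (hkg j).2.2
  have hj' : (0 : ℝ) < j := by exact_mod_cast hj
  have ha : (0 : ℝ) < cfA (iota α) (k j + 1) :=
    lt_of_le_of_lt (mul_nonneg hj'.le (Finset.sum_nonneg fun _ _ => Nat.cast_nonneg _)) hlt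
  rw [div_le_div_iff₀ ha hj', one_mul, mul_comm]
  exact hlt.le
end

section
/- Let ν ∈ ℕ and β₁, β₂, …, β_ν ∈ 𝕋 \ {0}. Then there exists δ > 0 such that the set {N ∈ ℕ : ‖Nβ_j‖ > δ for all 1 ≤ j ≤ ν} has positive lower density. -/
open MeasureTheory Filter Set Topology

/-- A set whose counting function dominates `a * N` has lower density at least `a`. -/
theorem le_lowerDensity_of_forall_mul_le {A : Set ℕ} {a : ℝ}
    (h : ∀ N : ℕ, ∃ s : Finset ℕ, (∀ n ∈ s, n ∈ Finset.Icc 1 N ∧ n ∈ A) ∧ a * N ≤ s.card) :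
    a ≤ lowerDensity A := by
  classical
  refine le_liminf_of_le (IsBoundedUnder.isCoboundedUnder_ge ?_) ?_
  · refine isBoundedUnder_of ⟨1, fun N => div_le_one_of_le₀ ?_ (by positivity)⟩
    exact_mod_cast (Finset.card_filter_le _ _).trans_eq (by simp)
  · filter_upwards [eventually_gt_atTop 0] with N hN
    obtain ⟨s, hs, hcard⟩ := h N
    rw [le_div_iff₀ (by exact_mod_cast hN)]
    refine hcard.trans ?_
    exact_mod_cast Finset.card_le_card fun n hn => Finset.mem_filter.2 (hs n hn)

/-- In a compact seminormed group, the multiples of a point return to a ball around `0` with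
frequency bounded below, uniformly over initial segments. -/
theorem exists_pos_forall_mul_le_card_norm_nsmul_lt {G : Type*} [SeminormedAddCommGroup G]
    [CompactSpace G] (x : G) {ε : ℝ} (hε : 0 < ε) :
    ∃ a : ℝ, 0 < a ∧ ∀ N : ℕ, ∃ s : Finset ℕ,
      (∀ n ∈ s, n < N ∧ ‖n • x‖ < ε) ∧ a * N ≤ s.card := by
  classical
  obtain ⟨t, -, htfin, ht⟩ := finite_cover_balls_of_compact (isCompact_univ (X := G)) (half_pos hε)
  lift t to Finset G using htfin
  have hcover : ∀ n : ℕ, ∃ y ∈ t, dist (n • x) y < ε / 2 := fun n => by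
    simpa using ht (mem_univ (n • x))
  choose f hft hf using hcover
  have hne : t.Nonempty := ⟨f 0, hft 0⟩
  have hpos : (0 : ℝ) < t.card := by exact_mod_cast hne.card_pos
  refine ⟨(t.card : ℝ)⁻¹, inv_pos.2 hpos, fun N => ?_⟩
  obtain ⟨y, -, hy⟩ := Finset.exists_le_card_fiber_of_nsmul_le_card_of_maps_to
    (s := Finset.range N) (b := (t.card : ℝ)⁻¹ * N) (fun n _ => hft n) hne
    (by simp [nsmul_eq_mul, mul_inv_cancel_left₀ hpos.ne'])
  set u := (Finset.range N).filter (fun n => f n = y)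
  rcases u.eq_empty_or_nonempty with hu | hu
  · exact ⟨∅, by simp, by simpa [hu] using hy⟩
  set m := u.min' hu
  have hle : ∀ n ∈ u, m ≤ n := fun n hn => u.min'_le n hn
  have hm : f m = y := (Finset.mem_filter.1 (u.min'_mem hu)).2
  refine ⟨u.image (· - m), fun k hk => ?_, ?_⟩
  · obtain ⟨n, hn, rfl⟩ := Finset.mem_image.1 hk
    obtain ⟨hnN, hny⟩ := Finset.mem_filter.1 hn
    refine ⟨(Nat.sub_le _ _).trans_lt (Finset.mem_range.1 hnN), ?_⟩
    have hsub : (n - m) • x = n • x - m • x :=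
      eq_sub_of_add_eq (by rw [← add_nsmul, Nat.sub_add_cancel (hle n hn)])
    have h₁ := hf n
    have h₂ := hf m
    rw [hny] at h₁
    rw [hm] at h₂
    change ‖(n - m) • x‖ < ε
    rw [hsub, ← dist_eq_norm]
    linarith [dist_triangle_right (n • x) (m • x) y]
  · rwa [Finset.card_image_of_injOn]
    intro p hp q hq hpq
    have := hle p hp
    have := hle q hq
    simp only at hpq
    omega

/-- Given finitely many nonzero points `β i ∈ 𝕋`, there is a `δ > 0` such that the set of
`N ∈ ℕ` with `‖N β_i‖ > δ` for all `i` has positive lower density. -/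
theorem positive_density_isolated_multiples (ν : ℕ) (β : Fin ν → UnitAddCircle)
    (hβ : ∀ i, β i ≠ 0) :
    ∃ δ : ℝ, 0 < δ ∧ 0 < lowerDensity {N : ℕ | ∀ i, δ < ‖N • β i‖} := by
  obtain ⟨δ, hδ, hδβ⟩ : ∃ δ : ℝ, 0 < δ ∧ ∀ i, 2 * δ ≤ ‖β i‖ := by
    have hev : ∀ᶠ δ : ℝ in 𝓝[>] 0, ∀ i, 2 * δ ≤ ‖β i‖ := by
      refine eventually_all.2 fun i => ?_
      filter_upwards [Ioo_mem_nhdsGT (half_pos (norm_pos_iff.2 (hβ i)))] with δ hδ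
      linarith [hδ.2]
    obtain ⟨δ, h, hδ⟩ := (hev.and self_mem_nhdsWithin).exists
    exact ⟨δ, hδ, h⟩
  obtain ⟨a, ha, h⟩ := exists_pos_forall_mul_le_card_norm_nsmul_lt β hδ
  refine ⟨δ, hδ, ha.trans_le (le_lowerDensity_of_forall_mul_le fun N => ?_)⟩
  obtain ⟨s, hs, hcard⟩ := h N
  refine ⟨s.map (addRightEmbedding 1), fun n hn => ?_, by rwa [Finset.card_map]⟩
  obtain ⟨k, hk, rfl⟩ := Finset.mem_map.1 hn
  obtain ⟨hkN, hkβ⟩ := hs k hk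
  refine ⟨by simp; omega, fun i => ?_⟩
  have hki : ‖k • β i‖ < δ := (norm_le_pi_norm (k • β) i).trans_lt hkβ
  have htri := norm_sub_le ((k + 1) • β i) (k • β i)
  rw [succ_nsmul, add_sub_cancel_left] at htri
  change δ < ‖(k + 1) • β i‖
  rw [succ_nsmul]
  linarith [hδβ i]
end
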